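/- arXiv:2012.03020 — 3 statements merged into one kernel-verified Lean document; each statement's English description precedes it below -/
import Mathlib

section
/- For the 3-periodic billiard family, the product of the areas of the f₁-inversive and f₂-inversive triangles is invariant and equals (ρ⁸/(8a⁸b²))·[(a⁴ + 2a²b² + 4b⁴)δ + a⁶ + (3/2)a⁴b² + 4b⁶], where δ = √(a⁴ − a²b² + b⁴). -/
noncomputable section

namespace BilliardInv

/-- A point of the plane. -/
abbrev Pt := ℝ × ℝ

/-- Euclidean dot product. -/
def dot (p q : Pt) : ℝ := p.1 * q.1 + p.2 * q.2

/-- Euclidean distance. -/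
def dst (p q : Pt) : ℝ := Real.sqrt ((p.1 - q.1) ^ 2 + (p.2 - q.2) ^ 2)

/-- Membership in the ellipse x²/a² + y²/b² = 1. -/
def onEllipse (a b : ℝ) (p : Pt) : Prop := p.1 ^ 2 / a ^ 2 + p.2 ^ 2 / b ^ 2 = 1

/-- Half the gradient of f(x,y) = x²/a² + y²/b² (an outward normal direction). -/
def nrm (a b : ℝ) (p : Pt) : Pt := (p.1 / a ^ 2, p.2 / b ^ 2)

/-- Unit vector pointing from `v` toward `q`. -/
def udir (v q : Pt) : Pt := (dst v q)⁻¹ • (q - v)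

/-- The billiard reflection law at vertex `v` with neighboring vertices `q`, `r`:
the two adjacent sides make equal angles with the ellipse normal at `v`. -/
def reflectAt (a b : ℝ) (q v r : Pt) : Prop :=
  dot (udir v q) (nrm a b v) = dot (udir v r) (nrm a b v)

/-- A 3-periodic billiard orbit in the ellipse with semi-axes `a > b > 0`:
a nondegenerate triangle inscribed in the ellipse obeying the reflection
law at each vertex. -/
structure Orbit3 (a b : ℝ) : Type where
  P1 : Pt
  P2 : Pt
  P3 : Pt
  h1 : onEllipse a b P1
  h2 : onEllipse a b P2
  h3 : onEllipse a b P3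
  d12 : P1 ≠ P2
  d23 : P2 ≠ P3
  d31 : P3 ≠ P1
  r1 : reflectAt a b P3 P1 P2
  r2 : reflectAt a b P1 P2 P3
  r3 : reflectAt a b P2 P3 P1

/-- Inversion of `p` with respect to the circle of radius `ρ` centered at `f`. -/
def inva (ρ : ℝ) (f p : Pt) : Pt :=
  f + (ρ ^ 2 / ((p.1 - f.1) ^ 2 + (p.2 - f.2) ^ 2)) • (p - f)

/-- Unsigned area of a triangle. -/
def area (A B C : Pt) : ℝ :=
  |(B.1 - A.1) * (C.2 - A.2) - (B.2 - A.2) * (C.1 - A.1)| / 2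

/-- The point with barycentric coordinates wA : wB : wC w.r.t. triangle ABC. -/
def bary (wA wB wC : ℝ) (A B C : Pt) : Pt :=
  (wA + wB + wC)⁻¹ • (wA • A + wB • B + wC • C)

/-- Side length a = |BC|. -/
def sA (A B C : Pt) : ℝ := dst B C
/-- Side length b = |CA|. -/
def sB (A B C : Pt) : ℝ := dst C A
/-- Side length c = |AB|. -/
def sC (A B C : Pt) : ℝ := dst A B

/-- Incenter X(1). -/
def incenter (A B C : Pt) : Pt := bary (sA A B C) (sB A B C) (sC A B C) A B C

/-- Barycenter (centroid) X(2). -/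
def centroid (A B C : Pt) : Pt := bary 1 1 1 A B C

/-- Circumcenter X(3), via its barycentric coordinates a²(b²+c²−a²) : · : ·. -/
def circumcenter (A B C : Pt) : Pt :=
  bary (sA A B C ^ 2 * (sB A B C ^ 2 + sC A B C ^ 2 - sA A B C ^ 2))
       (sB A B C ^ 2 * (sC A B C ^ 2 + sA A B C ^ 2 - sB A B C ^ 2))
       (sC A B C ^ 2 * (sA A B C ^ 2 + sB A B C ^ 2 - sC A B C ^ 2)) A B C

/-- Orthocenter X(4) = A + B + C − 2·(circumcenter). -/
def orthocenter (A B C : Pt) : Pt := A + B + C - (2 : ℝ) • circumcenter A B C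

/-- Nine-point center X(5): midpoint of circumcenter and orthocenter. -/
def ninePointCenter (A B C : Pt) : Pt :=
  ((1 : ℝ) / 2) • (circumcenter A B C + orthocenter A B C)

/-- Gergonne point X(7), barycentrics 1/(b+c−a) : 1/(c+a−b) : 1/(a+b−c). -/
def gergonne (A B C : Pt) : Pt :=
  bary (sB A B C + sC A B C - sA A B C)⁻¹
       (sC A B C + sA A B C - sB A B C)⁻¹
       (sA A B C + sB A B C - sC A B C)⁻¹ A B C

/-- Mittenpunkt X(9), barycentrics a(b+c−a) : b(c+a−b) : c(a+b−c). -/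
def mittenpunkt (A B C : Pt) : Pt :=
  bary (sA A B C * (sB A B C + sC A B C - sA A B C))
       (sB A B C * (sC A B C + sA A B C - sB A B C))
       (sC A B C * (sA A B C + sB A B C - sC A B C)) A B C

/-- Feuerbach point X(11), barycentrics (b+c−a)(b−c)² : · : ·. -/
def feuerbach (A B C : Pt) : Pt :=
  bary ((sB A B C + sC A B C - sA A B C) * (sB A B C - sC A B C) ^ 2)
       ((sC A B C + sA A B C - sB A B C) * (sC A B C - sA A B C) ^ 2)
       ((sA A B C + sB A B C - sC A B C) * (sA A B C - sB A B C) ^ 2) A B C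

/-- Triangle center X(100), barycentrics a/(b−c) : b/(c−a) : c/(a−b). -/
def X100 (A B C : Pt) : Pt :=
  bary (sA A B C / (sB A B C - sC A B C))
       (sB A B C / (sC A B C - sA A B C))
       (sC A B C / (sA A B C - sB A B C)) A B C

/-- Orthogonal projection of `Q` onto the line through `A` and `B`. -/
def projLine (Q A B : Pt) : Pt :=
  A + (dot (Q - A) (B - A) / dot (B - A) (B - A)) • (B - A)

/-- Unsigned area of the pedal triangle of `Q` w.r.t. triangle `A B C`. -/
def pedalArea (Q A B C : Pt) : ℝ :=
  area (projLine Q A B) (projLine Q B C) (projLine Q C A)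

end BilliardInv

open BilliardInv Real


lemma conj_unit (x y : ℝ) (h : x^2+y^2=1) : (⟨x,y⟩:ℂ) * ⟨x,-y⟩ = 1 := by
  apply Complex.ext
  · simp; linear_combination h
  · simp; ring

/-- A chord of the unit circle with `m = 1 - cos` satisfies the Joachimsthal relation. -/
lemma pair_rel (a b j x y x' y' : ℝ) (h : x^2+y^2=1) (h' : x'^2+y'^2=1)
    (hne : 1 - x*x' - y*y' ≠ 0)
    (hj : (1 - x*x' - y*y')^2 = j * (a^2*(x-x')^2 + b^2*(y-y')^2)) :
    1 - x*x' - y*y' = j*(a^2+b^2 - (a^2-b^2)*(x*x'-y*y')) := by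
  have e1 : (x-x')^2 = (1 - x*x' - y*y')*(1 - x*x' + y*y') := by
    have : y^2*y'^2 = (1-x^2)*(1-x'^2) := by
      rw [show y^2 = 1-x^2 by linarith, show y'^2 = 1-x'^2 by linarith]
    linear_combination this
  have e2 : (y-y')^2 = (1 - x*x' - y*y')*(1 + x*x' - y*y') := by
    have : x^2*x'^2 = (1-y^2)*(1-y'^2) := by
      rw [show x^2 = 1-y^2 by linarith, show x'^2 = 1-y'^2 by linarith]
    linear_combination this
  apply mul_left_cancel₀ hne
  rw [e1, e2] at hj
  linear_combination hj

lemma quad_zero (A B C z1 z2 z3 : ℂ) (h12 : z1 ≠ z2) (h23 : z2 ≠ z3) (h31 : z3 ≠ z1)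
    (h1 : A*z1^2+B*z1+C=0) (h2 : A*z2^2+B*z2+C=0) (h3 : A*z3^2+B*z3+C=0) :
    A = 0 ∧ B = 0 ∧ C = 0 := by
  have k12 : A*(z1+z2)+B = 0 := by
    apply mul_left_cancel₀ (sub_ne_zero.2 h12); linear_combination h1-h2
  have k23 : A*(z2+z3)+B = 0 := by
    apply mul_left_cancel₀ (sub_ne_zero.2 h23); linear_combination h2-h3
  have hA : A = 0 := by
    apply mul_left_cancel₀ (sub_ne_zero.2 h31); linear_combination k23-k12
  subst hA
  have hB : B = 0 := by linear_combination k12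
  subst hB
  exact ⟨rfl, rfl, by linear_combination h1⟩

lemma vertex_quad (κ γ z z' z'' : ℂ) (hz : z ≠ 0)
    (h : z'^2+z''^2 - κ*(z'^2*z''^2+1) = 2*γ*(z'*z'')) :
    (-(z*z'+z'*z''+z''*z) - κ)*z^2
     + ((z+z'+z'')*(z*z'+z'*z''+z''*z) + z*z'*z'' - 2*(1+γ)*(z*z'*z''))*z
     + (-(z*z'*z'')*(z+z'+z'') - κ*(z*z'*z'')^2) = 0 := by
  linear_combination z^2*h

/-- conversion of the real bilinear relation to a complex one -/
lemma pair_complex (κ γ x y x' y' : ℝ) (h : x^2+y^2=1) (h' : x'^2+y'^2=1)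
    (hr : x*x'+y*y' - κ*(x*x'-y*y') = γ) :
    (⟨x,y⟩:ℂ)^2+(⟨x',y'⟩:ℂ)^2 - (κ:ℂ)*((⟨x,y⟩:ℂ)^2*(⟨x',y'⟩:ℂ)^2+1)
      = 2*(γ:ℂ)*((⟨x,y⟩:ℂ)*(⟨x',y'⟩:ℂ)) := by
  have hz : (⟨x,y⟩:ℂ) * ⟨x,-y⟩ = 1 := conj_unit _ _ h
  have hz' : (⟨x',y'⟩:ℂ) * ⟨x',-y'⟩ = 1 := conj_unit _ _ h'
  have hr' : (⟨x,y⟩:ℂ) * ⟨x',-y'⟩ + (⟨x,-y⟩:ℂ) * ⟨x',y'⟩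
      - κ * ((⟨x,y⟩:ℂ) * ⟨x',y'⟩ + (⟨x,-y⟩:ℂ) * ⟨x',-y'⟩) = 2 * γ := by
    apply Complex.ext
    · simp; linear_combination 2*hr
    · simp; ring
  generalize (⟨x,y⟩:ℂ) = z at *
  generalize (⟨x',y'⟩:ℂ) = z' at *
  generalize (⟨x,-y⟩:ℂ) = w at *
  generalize (⟨x',-y'⟩:ℂ) = w' at *
  linear_combination z*z'*hr' - z^2*hz' - z'^2*hz + κ*(z*w*hz' + hz)

/-- The poristic relations for the elementary symmetric functions. -/
lemma poristic (κ γ x1 y1 x2 y2 x3 y3 : ℝ) (h1 : x1^2+y1^2=1) (h2 : x2^2+y2^2=1)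
    (h3 : x3^2+y3^2=1)
    (d12 : (⟨x1,y1⟩:ℂ) ≠ ⟨x2,y2⟩) (d23 : (⟨x2,y2⟩:ℂ) ≠ ⟨x3,y3⟩) (d31 : (⟨x3,y3⟩:ℂ) ≠ ⟨x1,y1⟩)
    (r12 : x1*x2+y1*y2 - κ*(x1*x2-y1*y2) = γ)
    (r23 : x2*x3+y2*y3 - κ*(x2*x3-y2*y3) = γ)
    (r31 : x3*x1+y3*y1 - κ*(x3*x1-y3*y1) = γ) :
    κ^2 = 1+2*γ ∧
    (⟨x1,y1⟩:ℂ)*⟨x2,y2⟩+(⟨x2,y2⟩:ℂ)*⟨x3,y3⟩+(⟨x3,y3⟩:ℂ)*⟨x1,y1⟩ = -κ ∧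
    (⟨x1,y1⟩:ℂ)+⟨x2,y2⟩+⟨x3,y3⟩ = -κ*((⟨x1,y1⟩:ℂ)*⟨x2,y2⟩*⟨x3,y3⟩) := by
  have c12 := pair_complex κ γ x1 y1 x2 y2 h1 h2 r12
  have c23 := pair_complex κ γ x2 y2 x3 y3 h2 h3 r23
  have c31 := pair_complex κ γ x3 y3 x1 y1 h3 h1 r31
  have nz : ∀ x y : ℝ, x^2+y^2=1 → (⟨x,y⟩:ℂ) ≠ 0 := by
    intro x y h h0
    have := congrArg Complex.re h0
    have := congrArg Complex.im h0
    simp_all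
  have n1 := nz _ _ h1
  have n2 := nz _ _ h2
  have n3 := nz _ _ h3
  generalize (⟨x1,y1⟩:ℂ) = z1 at *
  generalize (⟨x2,y2⟩:ℂ) = z2 at *
  generalize (⟨x3,y3⟩:ℂ) = z3 at *
  have q1 := vertex_quad κ γ z1 z2 z3 n1 c23
  have q2 := vertex_quad κ γ z2 z3 z1 n2 c31
  have q3 := vertex_quad κ γ z3 z1 z2 n3 c12
  obtain ⟨A, B, C⟩ := quad_zero (-(z1*z2+z2*z3+z3*z1) - κ)
    ((z1+z2+z3)*(z1*z2+z2*z3+z3*z1) + z1*z2*z3 - 2*(1+γ)*(z1*z2*z3))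
    (-(z1*z2*z3)*(z1+z2+z3) - κ*(z1*z2*z3)^2) z1 z2 z3 d12 d23 d31
    (by linear_combination q1) (by linear_combination q2) (by linear_combination q3)
  have n : z1*z2*z3 ≠ 0 := by simp [n1, n2, n3]
  have E2 : z1*z2+z2*z3+z3*z1 = -(κ:ℂ) := by linear_combination -A
  have E1 : z1+z2+z3 = -κ*(z1*z2*z3) := by
    apply mul_left_cancel₀ n; linear_combination -C
  refine ⟨?_, E2, E1⟩
  rw [E1, E2] at B
  have : (κ:ℂ)^2 = 1+2*γ := by
    apply mul_left_cancel₀ n; linear_combination B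
  exact_mod_cast this

/-- Algebraic consequences. -/
lemma sym_facts (κ x1 y1 x2 y2 x3 y3 : ℝ) (h1 : x1^2+y1^2=1) (h2 : x2^2+y2^2=1)
    (h3 : x3^2+y3^2=1)
    (E2 : (⟨x1,y1⟩:ℂ)*⟨x2,y2⟩+(⟨x2,y2⟩:ℂ)*⟨x3,y3⟩+(⟨x3,y3⟩:ℂ)*⟨x1,y1⟩ = -κ)
    (E1 : (⟨x1,y1⟩:ℂ)+⟨x2,y2⟩+⟨x3,y3⟩ = -κ*((⟨x1,y1⟩:ℂ)*⟨x2,y2⟩*⟨x3,y3⟩)) :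
    ∃ X Y : ℝ, x1+x2+x3 = -κ*X ∧ x1*x2+x2*x3+x3*x1 = (κ-3)*(κ+1)/4 ∧
      x1*x2*x3 = (1+κ)^2*X/4 ∧
      2*x1^2 = 1+κ+(1-κ)*X*x1+(1+κ)*Y*y1 ∧
      2*x2^2 = 1+κ+(1-κ)*X*x2+(1+κ)*Y*y2 ∧
      2*x3^2 = 1+κ+(1-κ)*X*x3+(1+κ)*Y*y3 ∧
      4*((x2-x1)*(y3-y1)-(y2-y1)*(x3-x1))^2 = (3-κ)^3*(1+κ) - 16*κ^3*X^2 := by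
  set e : ℂ := (⟨x1,y1⟩:ℂ)*⟨x2,y2⟩*⟨x3,y3⟩ with he
  have sq : ∀ x y p q r s: ℝ, x^2+y^2=1 → e = ⟨x,y⟩*(⟨p,q⟩*⟨r,s⟩) →
      (⟨x,y⟩:ℂ)*⟨p,q⟩ + ⟨p,q⟩*⟨r,s⟩ + ⟨r,s⟩*⟨x,y⟩ = -κ →
      (⟨x,y⟩:ℂ)+⟨p,q⟩+⟨r,s⟩ = -κ*e →
      2*x^2 = 1+κ+(1-κ)*e.re*x+(1+κ)*e.im*y := by
    intro x y p q r s h hee f2 f1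
    have hz : (⟨x,y⟩:ℂ) * ⟨x,-y⟩ = 1 := conj_unit _ _ h
    have key : (⟨x,y⟩:ℂ)^2 = κ + e * ⟨x,-y⟩ - κ*e*⟨x,y⟩ := by
      generalize (⟨x,y⟩:ℂ) = z at *
      generalize (⟨p,q⟩:ℂ) = z' at *
      generalize (⟨r,s⟩:ℂ) = z'' at *
      generalize (⟨x,-y⟩:ℂ) = w at *
      have : e*w = z'*z'' := by rw [hee]; linear_combination z'*z''*hz
      rw [this]
      linear_combination -f2 + z*f1
    have := congrArg Complex.re key
    simp [pow_two] at this
    linear_combination this + h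
  have s1 := sq x1 y1 x2 y2 x3 y3 h1 (by rw [he]; ring) E2 E1
  have s2 := sq x2 y2 x3 y3 x1 y1 h2 (by rw [he]; ring) (by linear_combination E2)
    (by linear_combination E1)
  have s3 := sq x3 y3 x1 y1 x2 y2 h3 (by rw [he]; ring) (by linear_combination E2)
    (by linear_combination E1)
  have hX : e.re = (x1*x2-y1*y2)*x3 - (x1*y2+y1*x2)*y3 := by simp [he]
  have hY : e.im = (x1*x2-y1*y2)*y3 + (x1*y2+y1*x2)*x3 := by simp [he]
  have hn : e.re^2+e.im^2 = 1 := by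
    have : e.re^2+e.im^2 = (x1^2+y1^2)*(x2^2+y2^2)*(x3^2+y3^2) := by rw [hX, hY]; ring
    rw [this, h1, h2, h3]; norm_num
  have F1 : x1+x2+x3 = -κ*e.re := by
    have := congrArg Complex.re E1
    simpa using this
  have G1 : y1+y2+y3 = -κ*e.im := by
    have := congrArg Complex.im E1
    simpa using this
  have F2 : x1*x2-y1*y2+(x2*x3-y2*y3)+(x3*x1-y3*y1) = -κ := by
    have := congrArg Complex.re E2
    simpa using this
  have P2 : x1*x2+x2*x3+x3*x1 = (κ-3)*(κ+1)/4 := by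
    have : (x1+x2+x3)^2+(y1+y2+y3)^2 = κ^2 := by
      rw [F1, G1]; linear_combination κ^2*hn
    linear_combination (1/4)*this - (1/4)*(h1+h2+h3) + (1/2)*F2
  refine ⟨e.re, e.im, F1, P2, ?_, s1, s2, s3, ?_⟩
  · show x1*x2*x3 = (1+κ)^2*e.re/4
    have t : ∀ x y p q r s : ℝ, x^2+y^2=1 → e.re = (x*p-y*q)*r-(x*q+y*p)*s →
        e.im = (x*p-y*q)*s+(x*q+y*p)*r →
        p*r*x - q*s*x + (p*s+q*r)*y = (x^2-y^2)*e.re+2*x*y*e.im := by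
      intro x y p q r s h hx hy
      rw [hx, hy]
      linear_combination (-(p*r*x - q*s*x + (p*s+q*r)*y))*h
    have t1 := t x1 y1 x2 y2 x3 y3 h1 (by rw [hX]) (by rw [hY])
    have t2 := t x2 y2 x3 y3 x1 y1 h2 (by rw [hX]; ring) (by rw [hY]; ring)
    have t3 := t x3 y3 x1 y1 x2 y2 h3 (by rw [hX]; ring) (by rw [hY]; ring)
    have u1 : (x1+x2+x3)^2-(y1+y2+y3)^2 = κ^2*(e.re^2-e.im^2) := by rw [F1, G1]; ring
    have u2 : (x1+x2+x3)*(y1+y2+y3) = κ^2*(e.re*e.im) := by rw [F1, G1]; ring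
    have G2 : x1*y2+y1*x2+(x2*y3+y2*x3)+(x3*y1+y3*x1) = 0 := by
      have := congrArg Complex.im E2
      simpa using this
    have v1 : x1^2-y1^2+(x2^2-y2^2)+(x3^2-y3^2) = κ^2*(e.re^2-e.im^2)+2*κ := by
      linear_combination u1 - 2*F2
    have v2 : x1*y1+x2*y2+x3*y3 = κ^2*(e.re*e.im) := by
      linear_combination u2 - G2
    linear_combination (1/4)*(t1+t2+t3) - (1/4)*hX + (1/4)*e.re*v1 + (1/2)*e.im*v2
      + (1/4)*κ^2*e.re*hn
  · set D := (x2-x1)*(y3-y1)-(y2-y1)*(x3-x1) with hD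
    have w1 : (⟨x1,y1⟩:ℂ) * ⟨x1,-y1⟩ = 1 := conj_unit _ _ h1
    have w2 : (⟨x2,y2⟩:ℂ) * ⟨x2,-y2⟩ = 1 := conj_unit _ _ h2
    have w3 : (⟨x3,y3⟩:ℂ) * ⟨x3,-y3⟩ = 1 := conj_unit _ _ h3
    have hDc : (⟨0, 2*D⟩:ℂ) = (⟨x1,-y1⟩:ℂ)*⟨x2,y2⟩ - ⟨x1,y1⟩*⟨x2,-y2⟩
      + ((⟨x2,-y2⟩:ℂ)*⟨x3,y3⟩ - ⟨x2,y2⟩*⟨x3,-y3⟩)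
      + ((⟨x3,-y3⟩:ℂ)*⟨x1,y1⟩ - ⟨x3,y3⟩*⟨x1,-y1⟩) := by
      apply Complex.ext <;> simp [hD] <;> ring
    have hsq : (⟨0, 2*D⟩:ℂ)^2 = -(4*(D:ℂ)^2) := by
      apply Complex.ext <;> simp [pow_two]; ring
    have hew : e * (starRingEnd ℂ e) = 1 := by
      rw [Complex.mul_conj, Complex.normSq_apply]
      exact_mod_cast (by linear_combination hn)
    have hes : e + (starRingEnd ℂ e) = 2*(e.re:ℂ) := by
      rw [Complex.add_conj]; push_cast; ring
    have e0 : e ≠ 0 := left_ne_zero_of_mul_eq_one hew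
    have main : (e*(⟨0, 2*D⟩:ℂ))^2 = κ^4*e^2+4*κ^3+4*κ^3*e^4-27*e^2+18*κ^2*e^2 := by
      rw [hDc]
      generalize (⟨x1,y1⟩:ℂ) = z1 at *
      generalize (⟨x2,y2⟩:ℂ) = z2 at *
      generalize (⟨x3,y3⟩:ℂ) = z3 at *
      generalize (⟨x1,-y1⟩:ℂ) = u1 at *
      generalize (⟨x2,-y2⟩:ℂ) = u2 at *
      generalize (⟨x3,-y3⟩:ℂ) = u3 at *
      have : e*(u1*z2 - z1*u2 + (u2*z3-z2*u3)+(u3*z1-z3*u1))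
          = -((z1-z2)*(z2-z3)*(z3-z1)) := by
        rw [he]
        linear_combination (z2*z3*(z2-z3))*w1 + (z1*z3*(z3-z1))*w2 + (z1*z2*(z1-z2))*w3
      rw [this]
      have disc : (-((z1-z2)*(z2-z3)*(z3-z1)))^2 =
         (z1+z2+z3)^2*(z1*z2+z2*z3+z3*z1)^2 - 4*(z1*z2+z2*z3+z3*z1)^3
          - 4*(z1+z2+z3)^3*(z1*z2*z3) - 27*(z1*z2*z3)^2
          + 18*(z1+z2+z3)*(z1*z2+z2*z3+z3*z1)*(z1*z2*z3) := by ring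
      rw [disc, E1, E2, ← he]
      ring
    rw [mul_pow, hsq] at main
    generalize (starRingEnd ℂ e) = f at *
    have fin : 4*(D:ℂ)^2 = (3-κ)^3*(1+κ) - 16*κ^3*(e.re:ℂ)^2 := by
      have : (e.re:ℂ) = (e+f)/2 := by rw [hes]; ring
      rw [this]
      apply mul_left_cancel₀ (pow_ne_zero 2 e0)
      linear_combination -main + 4*κ^3*(e*f+1+2*e^2)*hew
    exact_mod_cast fin

lemma dot_udir (a b : ℝ) (ha : a ≠ 0) (hb : b ≠ 0) (v q : Pt) (hv : onEllipse a b v) :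
    dot (udir v q) (nrm a b v) =
      -((1 - v.1/a*(q.1/a) - v.2/b*(q.2/b)) / dst v q) := by
  unfold onEllipse at hv
  simp only [dot, udir, nrm, Prod.smul_fst, Prod.smul_snd, Prod.fst_sub, Prod.snd_sub,
    smul_eq_mul]
  rw [← hv]
  field_simp
  ring

lemma dst_comm' (p q : Pt) : dst p q = dst q p := by
  unfold dst; congr 1; ring

lemma dst_pos' (p q : Pt) (h : p ≠ q) : 0 < dst p q := by
  unfold dst
  apply Real.sqrt_pos.2
  by_contra hn
  apply h
  have h1 := sq_nonneg (p.1-q.1)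
  have h2 := sq_nonneg (p.2-q.2)
  have : (p.1-q.1)^2 = 0 := by linarith
  have : (p.2-q.2)^2 = 0 := by linarith
  apply Prod.ext
  · exact sub_eq_zero.1 (by simpa using ‹(p.1-q.1)^2 = 0›)
  · exact sub_eq_zero.1 (by simpa using ‹(p.2-q.2)^2 = 0›)

/-- Existence of κ together with the relations. -/
lemma orbit_kappa (a b : ℝ) (hab : a > b) (hb : b > 0) (T : Orbit3 a b) :
    ∃ κ X Y x1 y1 x2 y2 x3 y3 : ℝ, 0 < κ ∧ κ < 1 ∧
      4*κ*a^2 = (a^2-b^2)*((3-κ)*(1+κ)) ∧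
      T.P1 = (a*x1, b*y1) ∧ T.P2 = (a*x2, b*y2) ∧ T.P3 = (a*x3, b*y3) ∧
      x1^2+y1^2=1 ∧ x2^2+y2^2=1 ∧ x3^2+y3^2=1 ∧
      x1+x2+x3 = -κ*X ∧ x1*x2+x2*x3+x3*x1 = (κ-3)*(κ+1)/4 ∧
      x1*x2*x3 = (1+κ)^2*X/4 ∧
      2*x1^2 = 1+κ+(1-κ)*X*x1+(1+κ)*Y*y1 ∧
      2*x2^2 = 1+κ+(1-κ)*X*x2+(1+κ)*Y*y2 ∧
      2*x3^2 = 1+κ+(1-κ)*X*x3+(1+κ)*Y*y3 ∧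
      4*((x2-x1)*(y3-y1)-(y2-y1)*(x3-x1))^2 = (3-κ)^3*(1+κ) - 16*κ^3*X^2 := by
  have ha : a > 0 := by linarith
  have ha0 := ha.ne'
  have hb0 := hb.ne'
  obtain ⟨P1, P2, P3, h1, h2, h3, d12, d23, d31, r1, r2, r3⟩ := T
  obtain ⟨x1, y1, rfl⟩ : ∃ x y, P1 = (a*x, b*y) :=
    ⟨P1.1/a, P1.2/b, by ext <;> field_simp⟩
  obtain ⟨x2, y2, rfl⟩ : ∃ x y, P2 = (a*x, b*y) :=
    ⟨P2.1/a, P2.2/b, by ext <;> field_simp⟩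
  obtain ⟨x3, y3, rfl⟩ : ∃ x y, P3 = (a*x, b*y) :=
    ⟨P3.1/a, P3.2/b, by ext <;> field_simp⟩
  unfold reflectAt at r1 r2 r3
  rw [dot_udir a b ha0 hb0 _ _ h1, dot_udir a b ha0 hb0 _ _ h1] at r1
  rw [dot_udir a b ha0 hb0 _ _ h2, dot_udir a b ha0 hb0 _ _ h2] at r2
  have H : ∀ x y : ℝ, onEllipse a b (a*x, b*y) → x^2+y^2=1 := by
    intro x y h
    unfold onEllipse at h
    rw [← h]; field_simp
  have g1 := H _ _ h1
  have g2 := H _ _ h2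
  have g3 := H _ _ h3
  simp only [mul_div_cancel_left₀ _ ha0, mul_div_cancel_left₀ _ hb0] at r1 r2
  have p12 := dst_pos' _ _ d12
  have p23 := dst_pos' _ _ d23
  have p31 := dst_pos' _ _ d31
  rw [dst_comm' (a*x1, b*y1) (a*x3, b*y3)] at r1
  rw [dst_comm' (a*x2, b*y2) (a*x1, b*y1)] at r2
  have N : ∀ x y x' y' : ℝ, x^2+y^2=1 → x'^2+y'^2=1 → (a*x, b*y) ≠ (a*x', b*y') →
      1 - x*x' - y*y' ≠ 0 := by
    intro x y x' y' h h' hne h0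
    apply hne
    have e : (x-x')^2+(y-y')^2 = 0 := by linear_combination h + h' + 2*h0
    have k1 := sq_nonneg (x-x')
    have k2 := sq_nonneg (y-y')
    have l1 : x-x' = 0 := by
      have : (x-x')^2 = 0 := by linarith
      simpa using this
    have l2 : y-y' = 0 := by
      have : (y-y')^2 = 0 := by linarith
      simpa using this
    rw [sub_eq_zero.1 l1, sub_eq_zero.1 l2]
  have n12 := N _ _ _ _ g1 g2 d12
  have n23 := N _ _ _ _ g2 g3 d23
  have n31 := N _ _ _ _ g3 g1 d31
  have S : ∀ x y x' y' : ℝ, dst (a*x, b*y) (a*x', b*y')^2 = a^2*(x-x')^2+b^2*(y-y')^2 := by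
    intro x y x' y'
    unfold dst
    rw [Real.sq_sqrt (by positivity)]
    ring
  obtain ⟨J, hJ⟩ : ∃ J, J = (1 - x1*x2 - y1*y2) / dst (a*x1, b*y1) (a*x2, b*y2) := ⟨_, rfl⟩
  have j12 : 1 - x1*x2 - y1*y2 = J * dst (a*x1, b*y1) (a*x2, b*y2) := by
    rw [hJ, div_mul_cancel₀ _ p12.ne']
  have j31 : 1 - x3*x1 - y3*y1 = J * dst (a*x3, b*y3) (a*x1, b*y1) := by
    have : J = (1 - x1*x3 - y1*y3) / dst (a*x3, b*y3) (a*x1, b*y1) := by linarith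
    rw [this, div_mul_cancel₀ _ p31.ne']; ring
  have j23 : 1 - x2*x3 - y2*y3 = J * dst (a*x2, b*y2) (a*x3, b*y3) := by
    have : J = (1 - x2*x3 - y2*y3) / dst (a*x2, b*y2) (a*x3, b*y3) := by
      rw [hJ]
      rw [show 1 - x1*x2 - y1*y2 = 1 - x2*x1 - y2*y1 by ring]
      linarith
    rw [this, div_mul_cancel₀ _ p23.ne']
  have J0 : J ≠ 0 := by
    rintro rfl
    apply n12; rw [j12]; ring
  have b12 := pair_rel a b (J^2) x1 y1 x2 y2 g1 g2 n12 (by rw [← S, ← mul_pow, ← j12])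
  have b23 := pair_rel a b (J^2) x2 y2 x3 y3 g2 g3 n23 (by rw [← S, ← mul_pow, ← j23])
  have b31 := pair_rel a b (J^2) x3 y3 x1 y1 g3 g1 n31 (by rw [← S, ← mul_pow, ← j31])
  have C : ∀ x y x' y' : ℝ, (a*x, b*y) ≠ (a*x', b*y') → (⟨x,y⟩:ℂ) ≠ ⟨x',y'⟩ := by
    intro x y x' y' h h'
    apply h
    rw [Complex.mk.injEq] at h'
    rw [h'.1, h'.2]
  obtain ⟨K, E2, E1⟩ := poristic (J^2*(a^2-b^2)) (1-J^2*(a^2+b^2)) x1 y1 x2 y2 x3 y3 g1 g2 g3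
    (C _ _ _ _ d12) (C _ _ _ _ d23) (C _ _ _ _ d31)
    (by linear_combination -b12) (by linear_combination -b23) (by linear_combination -b31)
  obtain ⟨X, Y, F⟩ := sym_facts _ x1 y1 x2 y2 x3 y3 g1 g2 g3 E2 E1
  have hJ2 : 0 < J^2 := by positivity
  have hc : 0 < a^2-b^2 := by
    rw [show a^2-b^2 = (a-b)*(a+b) by ring]
    exact mul_pos (by linarith) (by linarith)
  have hκ : 0 < J^2*(a^2-b^2) := by positivity
  refine ⟨J^2*(a^2-b^2), X, Y, x1, y1, x2, y2, x3, y3, hκ, ?_, ?_, rfl, rfl, rfl,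
    g1, g2, g3, F⟩
  · have : J^2*(a^2-b^2) < J^2*(a^2+b^2) := by
      apply mul_lt_mul_of_pos_left _ hJ2
      have : 0 < b^2 := by positivity
      linarith
    by_contra hh
    push Not at hh
    have := one_le_pow₀ hh (n := 2)
    linarith
  · linear_combination (a^2-b^2)*K

/-- One inversive area. -/
lemma area_one (a b c κ X Y x1 y1 x2 y2 x3 y3 ρ : ℝ) (ha : 0 < a) (hb : 0 < b)
    (hκ : 0 < κ) (hκ1 : κ < 1) (hc : c^2 = a^2-b^2) (hca : |c| < a)
    (hA : 4*κ*a^2 = c^2*((3-κ)*(1+κ)))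
    (g1 : x1^2+y1^2=1) (g2 : x2^2+y2^2=1) (g3 : x3^2+y3^2=1)
    (F1 : x1+x2+x3 = -κ*X) (F2 : x1*x2+x2*x3+x3*x1 = (κ-3)*(κ+1)/4)
    (F3 : x1*x2*x3 = (1+κ)^2*X/4)
    (s1 : 2*x1^2 = 1+κ+(1-κ)*X*x1+(1+κ)*Y*y1)
    (s2 : 2*x2^2 = 1+κ+(1-κ)*X*x2+(1+κ)*Y*y2)
    (s3 : 2*x3^2 = 1+κ+(1-κ)*X*x3+(1+κ)*Y*y3) :
    0 < (1-κ)*(a^3 - c^3*(1+κ)*X/2) ∧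
    area (inva ρ (-c,0) (a*x1,b*y1)) (inva ρ (-c,0) (a*x2,b*y2)) (inva ρ (-c,0) (a*x3,b*y3))
     = ρ^4*b/(2*(1+κ)) * |(x2-x1)*(y3-y1)-(y2-y1)*(x3-x1)|
        / ((1-κ)*(a^3 - c^3*(1+κ)*X/2)) := by
  have pos : ∀ x y : ℝ, x^2+y^2=1 → 0 < a + c*x := by
    intro x y h
    have hx : |x| ≤ 1 := by
      rw [abs_le_one_iff_mul_self_le_one]; nlinarith [sq_nonneg y]
    have : |c*x| ≤ |c| := by
      rw [abs_mul]; exact mul_le_of_le_one_right (abs_nonneg _) hx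
    have := neg_abs_le (c*x)
    linarith
  have q1 := pos _ _ g1
  have q2 := pos _ _ g2
  have q3 := pos _ _ g3
  have hR : (a+c*x1)*(a+c*x2)*(a+c*x3) = (1-κ)*(a^3 - c^3*(1+κ)*X/2) := by
    linear_combination a^2*c*F1 + a*c^2*F2 + c^3*F3 + (a/4 - c*X/4)*hA
  have hRpos : 0 < (a+c*x1)*(a+c*x2)*(a+c*x3) := by positivity
  have rr : ∀ x y : ℝ, x^2+y^2=1 → (a*x+c)^2+(b*y)^2 = (a+c*x)^2 := by
    intro x y h
    linear_combination (-x^2)*hc + b^2*h + (1-x^2-y^2)*0 + hc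
  refine ⟨hR ▸ hRpos, ?_⟩
  rw [← hR]
  have k0 : (1+κ) ≠ 0 := by positivity
  have hE : (a+c*x1)^2*((a*x2+c)*(b*y3)-(b*y2)*(a*x3+c))
      + (a+c*x2)^2*((a*x3+c)*(b*y1)-(b*y3)*(a*x1+c))
      + (a+c*x3)^2*((a*x1+c)*(b*y2)-(b*y1)*(a*x2+c))
      = b/(1+κ) * ((x2-x1)*(y3-y1)-(y2-y1)*(x3-x1)) * ((a+c*x1)*(a+c*x2)*(a+c*x3)) := by
    rw [hR]
    have l : (a+c*x1)^2*((a*x2+c)*(b*y3)-(b*y2)*(a*x3+c))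
      + (a+c*x2)^2*((a*x3+c)*(b*y1)-(b*y3)*(a*x1+c))
      + (a+c*x3)^2*((a*x1+c)*(b*y2)-(b*y1)*(a*x2+c))
      = b * ((x2-x1)*(y3-y1)-(y2-y1)*(x3-x1)) *
        (a^3-2*a*c^2+a*c^2/2*(1+κ)-c^3/2*(1-κ)*X) := by
      linear_combination (c^2/2*((a*x2+c)*(b*y3)-(b*y2)*(a*x3+c)))*s1
        + (c^2/2*((a*x3+c)*(b*y1)-(b*y3)*(a*x1+c)))*s2
        + (c^2/2*((a*x1+c)*(b*y2)-(b*y1)*(a*x2+c)))*s3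
    have m : (1-κ)*(a^3 - c^3*(1+κ)*X/2)
        = (1+κ)*(a^3-2*a*c^2+a*c^2/2*(1+κ)-c^3/2*(1-κ)*X) := by
      linear_combination (-a/2)*hA
    rw [l, m]
    field_simp
  unfold area inva
  simp only [Prod.fst_add, Prod.snd_add, Prod.smul_fst, Prod.smul_snd, Prod.fst_sub,
    Prod.snd_sub, smul_eq_mul, sub_neg_eq_add, sub_zero, zero_add]
  rw [rr _ _ g1, rr _ _ g2, rr _ _ g3]
  have hd : (-c + ρ^2/(a+c*x2)^2*(a*x2+c) - (-c + ρ^2/(a+c*x1)^2*(a*x1+c))) *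
      (ρ^2/(a+c*x3)^2*(b*y3) - ρ^2/(a+c*x1)^2*(b*y1)) -
      (ρ^2/(a+c*x2)^2*(b*y2) - ρ^2/(a+c*x1)^2*(b*y1)) *
      (-c + ρ^2/(a+c*x3)^2*(a*x3+c) - (-c + ρ^2/(a+c*x1)^2*(a*x1+c)))
      = ρ^4 * ((a+c*x1)^2*((a*x2+c)*(b*y3)-(b*y2)*(a*x3+c))
      + (a+c*x2)^2*((a*x3+c)*(b*y1)-(b*y3)*(a*x1+c))
      + (a+c*x3)^2*((a*x1+c)*(b*y2)-(b*y1)*(a*x2+c))) / ((a+c*x1)*(a+c*x2)*(a+c*x3))^2 := by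
    field_simp
    ring
  rw [hd, hE]
  have : ρ ^ 4 * (b / (1 + κ) * ((x2 - x1) * (y3 - y1) - (y2 - y1) * (x3 - x1)) *
      ((a + c * x1) * (a + c * x2) * (a + c * x3))) /
      ((a + c * x1) * (a + c * x2) * (a + c * x3)) ^ 2 =
      (ρ^4*b/((1+κ)*((a + c * x1) * (a + c * x2) * (a + c * x3)))) *
        ((x2 - x1) * (y3 - y1) - (y2 - y1) * (x3 - x1)) := by
    field_simp
  rw [this, abs_mul, abs_of_nonneg (by positivity)]
  field_simp

/-- the product of the areas of the f₁-inversive and f₂-inversive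
triangles is invariant over the 3-periodic billiard family. -/
theorem focus_inversive_area_product (a b ρ : ℝ) (hab : a > b) (hb : b > 0)
    (hρ : ρ > 0) (T : Orbit3 a b) :
    let c : ℝ := Real.sqrt (a ^ 2 - b ^ 2)
    let δ : ℝ := Real.sqrt (a ^ 4 - a ^ 2 * b ^ 2 + b ^ 4)
    let f1 : Pt := (-c, 0)
    let f2 : Pt := (c, 0)
    area (inva ρ f1 T.P1) (inva ρ f1 T.P2) (inva ρ f1 T.P3) *
      area (inva ρ f2 T.P1) (inva ρ f2 T.P2) (inva ρ f2 T.P3) =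
      ρ ^ 8 / (8 * a ^ 8 * b ^ 2) *
        ((a ^ 4 + 2 * a ^ 2 * b ^ 2 + 4 * b ^ 4) * δ +
          a ^ 6 + 3 / 2 * a ^ 4 * b ^ 2 + 4 * b ^ 6) := by
  intro c δ f1 f2
  have ha : 0 < a := by linarith
  have hc2 : 0 < a^2-b^2 := by nlinarith
  obtain ⟨κ, X, Y, x1, y1, x2, y2, x3, y3, hκ, hκ1, hA, e1, e2, e3, g1, g2, g3, F1, F2, F3,
    s1, s2, s3, hD⟩ := orbit_kappa a b hab hb T
  have hc : c^2 = a^2-b^2 := Real.sq_sqrt hc2.le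
  have hcpos : 0 < c := Real.sqrt_pos.2 hc2
  have hca : c < a := by
    apply lt_of_pow_lt_pow_left₀ 2 ha.le
    have : 0 < b^2 := by positivity
    linarith
  rw [← hc] at hA
  have hB : 4*κ*b^2 = c^2*((3+κ)*(1-κ)) := by
    linear_combination hA + 4*κ*hc
  obtain ⟨R1, A1⟩ := area_one a b c κ X Y x1 y1 x2 y2 x3 y3 ρ ha hb hκ hκ1 hc
    (by rwa [abs_of_pos hcpos]) hA g1 g2 g3 F1 F2 F3 s1 s2 s3
  obtain ⟨R2, A2⟩ := area_one a b (-c) κ X Y x1 y1 x2 y2 x3 y3 ρ ha hb hκ hκ1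
    (by rw [neg_sq]; exact hc)
    (by rwa [abs_neg, abs_of_pos hcpos]) (by rw [neg_sq]; exact hA) g1 g2 g3 F1 F2 F3 s1 s2 s3
  rw [neg_neg] at A2
  rw [e1, e2, e3, A1, A2]
  set D := (x2-x1)*(y3-y1)-(y2-y1)*(x3-x1)
  have hδ : δ = c^2*(3+κ^2)/(4*κ) := by
    show Real.sqrt _ = _
    rw [Real.sqrt_eq_iff_mul_self_eq_of_pos (by positivity)]
    have ea : a^2 = c^2*((3-κ)*(1+κ))/(4*κ) := by field_simp; linarith
    have eb : b^2 = c^2*((3+κ)*(1-κ))/(4*κ) := by field_simp; linarith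
    rw [show a^4 = (a^2)^2 by ring, show b^4 = (b^2)^2 by ring, ea, eb]
    field_simp
    ring
  have ea : a^2 = c^2*((3-κ)*(1+κ))/(4*κ) := by field_simp; linarith
  have eb : b^2 = c^2*((3+κ)*(1-κ))/(4*κ) := by field_simp; linarith
  have hRR : ((1-κ)*(a^3 - c^3*(1+κ)*X/2)) * ((1-κ)*(a^3 - (-c)^3*(1+κ)*X/2))
      = (1-κ)^2*(1+κ)^2*c^6/(16*κ^3) * D^2 := by
    have : ((1-κ)*(a^3 - c^3*(1+κ)*X/2)) * ((1-κ)*(a^3 - (-c)^3*(1+κ)*X/2))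
      = (1-κ)^2*((a^2)^3 - c^6*(1+κ)^2*X^2/4) := by ring
    rw [this, show D^2 = ((3-κ)^3*(1+κ) - 16*κ^3*X^2)/4 by linarith, ea]
    field_simp
    ring
  have hpos := mul_pos R1 R2
  have hD0 : D ≠ 0 := by
    intro h0
    rw [hRR, h0] at hpos
    simp at hpos
  have k1 : 1-κ ≠ 0 := by linarith
  have k2 : 1+κ ≠ 0 := by positivity
  have k3 : 3-κ ≠ 0 := by linarith
  have k4 : 3+κ ≠ 0 := by positivity
  rw [div_mul_div_comm, hRR]
  have : ρ^4*b/(2*(1+κ))*|D| * (ρ^4*b/(2*(1+κ))*|D|) = ρ^8*b^2/(4*(1+κ)^2)*D^2 := by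
    rw [← sq_abs D]; field_simp; ring
  rw [this, hδ, show a^8 = (a^2)^4 by ring, show a^4 = (a^2)^2 by ring,
    show a^6 = (a^2)^3 by ring, show b^4 = (b^2)^2 by ring, show b^6 = (b^2)^3 by ring, ea, eb]
  field_simp
  ring
end
end

section
/- For the 3-periodic billiard family, the areas of the pedal triangle of f₁ with respect to the f₁-inversive triangle and the pedal triangle of f₂ with respect to the f₂-inversive triangle are equal for every orbit (though each is not constant over the family). -/
noncomputable section

open BilliardInv Real

namespace FocusAux

/-- Algebraic closing condition of the orbit in complex exponential coordinates. -/
lemma closing (z1 z2 z3 k S C : ℂ) (h12 : z1 ≠ z2) (h23 : z2 ≠ z3) (h31 : z3 ≠ z1)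
    (e12 : (z1 - z2) ^ 2 = k * (C * ((z1 * z2) ^ 2 + 1) - 2 * S * (z1 * z2)))
    (e23 : (z2 - z3) ^ 2 = k * (C * ((z2 * z3) ^ 2 + 1) - 2 * S * (z2 * z3)))
    (e31 : (z3 - z1) ^ 2 = k * (C * ((z3 * z1) ^ 2 + 1) - 2 * S * (z3 * z1))) :
    z1 + z2 + z3 = -(k * C) * (z1 * z2 * z3) ∧
    z1 * z2 + z2 * z3 + z3 * z1 = -(k * C) ∧
    3 - 2 * k * S - (k * C) ^ 2 = 0 := by
  have a1 : (3 - 2 * k * S + k * C * (z1 * z2 + z2 * z3 + z3 * z1)) * z1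
      = z1 + z2 + z3 + k * C * (z1 * z2 * z3) := by
    apply mul_left_cancel₀ (sub_ne_zero.mpr h23)
    linear_combination e31 - e12
  have a2 : (3 - 2 * k * S + k * C * (z1 * z2 + z2 * z3 + z3 * z1)) * z2
      = z1 + z2 + z3 + k * C * (z1 * z2 * z3) := by
    apply mul_left_cancel₀ (sub_ne_zero.mpr h31)
    linear_combination e12 - e23
  have b : 3 - 2 * k * S + k * C * (z1 * z2 + z2 * z3 + z3 * z1) = 0 := by
    have : (3 - 2 * k * S + k * C * (z1 * z2 + z2 * z3 + z3 * z1)) * (z1 - z2) = 0 := by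
      linear_combination a1 - a2
    exact (mul_eq_zero.mp this).resolve_right (sub_ne_zero.mpr h12)
  have s1 : z1 + z2 + z3 = -(k * C) * (z1 * z2 * z3) := by
    linear_combination z1 * b - a1
  have s2 : z1 * z2 + z2 * z3 + z3 * z1 = -(k * C) := by
    linear_combination (z1 + z2) * s1 - e12 - z1 * z2 * b
  refine ⟨s1, s2, ?_⟩
  linear_combination b - k * C * s2

/-- Bilinear form of the Joachimsthal condition. -/
lemma bilin (a b k X1 Y1 X2 Y2 : ℝ) (h1 : X1 ^ 2 + Y1 ^ 2 = 1) (h2 : X2 ^ 2 + Y2 ^ 2 = 1)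
    (hne : 1 - X1 * X2 - Y1 * Y2 ≠ 0)
    (h : (1 - X1 * X2 - Y1 * Y2) ^ 2 = k * (a ^ 2 * (X1 - X2) ^ 2 + b ^ 2 * (Y1 - Y2) ^ 2)) :
    1 - X1 * X2 - Y1 * Y2 = k * (a ^ 2 + b ^ 2 - (a ^ 2 - b ^ 2) * (X1 * X2 - Y1 * Y2)) := by
  have hx : (X1 - X2) ^ 2 = (1 - X1 * X2 - Y1 * Y2) * (1 - X1 * X2 + Y1 * Y2) := by
    linear_combination (1 - X2 ^ 2) * h1 + Y1 ^ 2 * h2 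
  have hy : (Y1 - Y2) ^ 2 = (1 - X1 * X2 - Y1 * Y2) * (1 + X1 * X2 - Y1 * Y2) := by
    linear_combination (1 - Y2 ^ 2) * h1 + X1 ^ 2 * h2
  apply mul_left_cancel₀ hne
  rw [hx, hy] at h
  linear_combination h

/-- Complex form of the bilinear relation. -/
lemma bilinC (k S C X1 Y1 X2 Y2 : ℝ) (h1 : X1 ^ 2 + Y1 ^ 2 = 1) (h2 : X2 ^ 2 + Y2 ^ 2 = 1)
    (h : 1 - X1 * X2 - Y1 * Y2 = k * (S - C * (X1 * X2 - Y1 * Y2))) :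
    (((X1 : ℂ) + Y1 * Complex.I) - ((X2 : ℂ) + Y2 * Complex.I)) ^ 2 =
      (k : ℂ) * (C * ((((X1 : ℂ) + Y1 * Complex.I) * ((X2 : ℂ) + Y2 * Complex.I)) ^ 2 + 1)
        - 2 * S * (((X1 : ℂ) + Y1 * Complex.I) * ((X2 : ℂ) + Y2 * Complex.I))) := by
  have h1' : (X1 : ℂ) ^ 2 + (Y1 : ℂ) ^ 2 = 1 := by exact_mod_cast h1
  have h2' : (X2 : ℂ) ^ 2 + (Y2 : ℂ) ^ 2 = 1 := by exact_mod_cast h2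
  have h' : (1 : ℂ) - X1 * X2 - Y1 * Y2 = k * (S - C * (X1 * X2 - Y1 * Y2)) := by
    exact_mod_cast h
  have i2 : Complex.I ^ 2 = -1 := Complex.I_sq
  obtain ⟨z1, hz1⟩ : ∃ z : ℂ, z = (X1 : ℂ) + Y1 * Complex.I := ⟨_, rfl⟩
  obtain ⟨z2, hz2⟩ : ∃ z : ℂ, z = (X2 : ℂ) + Y2 * Complex.I := ⟨_, rfl⟩
  obtain ⟨v1, hv1⟩ : ∃ z : ℂ, z = (X1 : ℂ) - Y1 * Complex.I := ⟨_, rfl⟩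
  obtain ⟨v2, hv2⟩ : ∃ z : ℂ, z = (X2 : ℂ) - Y2 * Complex.I := ⟨_, rfl⟩
  have p1 : z1 * v1 = 1 := by rw [hz1, hv1]; linear_combination h1' - (Y1 : ℂ) ^ 2 * i2
  have p2 : z2 * v2 = 1 := by rw [hz2, hv2]; linear_combination h2' - (Y2 : ℂ) ^ 2 * i2
  have hd : (X1 : ℂ) * X2 + Y1 * Y2 = (z1 * v2 + z2 * v1) / 2 := by
    rw [hz1, hz2, hv1, hv2]; linear_combination (Y1 : ℂ) * Y2 * i2
  have hs : (X1 : ℂ) * X2 - Y1 * Y2 = (z1 * z2 + v1 * v2) / 2 := by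
    rw [hz1, hz2, hv1, hv2]; linear_combination -(Y1 : ℂ) * Y2 * i2
  rw [← hz1, ← hz2]
  have h3 : 1 - (z1 * v2 + z2 * v1) / 2 = k * (S - C * ((z1 * z2 + v1 * v2) / 2)) := by
    rw [← hd, ← hs, ← h']; ring
  have q : z1 * z2 * (v1 * v2) = 1 := by linear_combination z2 * v2 * p1 + p2
  linear_combination (-2 * z1 * z2) * h3 - z1 ^ 2 * p2 - z2 ^ 2 * p1 + (k : ℂ) * C * q

/-- Real consequences of the closing condition. -/
lemma realFacts (a b k X1 Y1 X2 Y2 X3 Y3 : ℝ)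
    (h1 : X1 ^ 2 + Y1 ^ 2 = 1) (h2 : X2 ^ 2 + Y2 ^ 2 = 1) (h3 : X3 ^ 2 + Y3 ^ 2 = 1)
    (n12 : 1 - X1 * X2 - Y1 * Y2 ≠ 0) (n23 : 1 - X2 * X3 - Y2 * Y3 ≠ 0)
    (n31 : 1 - X3 * X1 - Y3 * Y1 ≠ 0)
    (e12 : (1 - X1 * X2 - Y1 * Y2) ^ 2 = k * (a ^ 2 * (X1 - X2) ^ 2 + b ^ 2 * (Y1 - Y2) ^ 2))
    (e23 : (1 - X2 * X3 - Y2 * Y3) ^ 2 = k * (a ^ 2 * (X2 - X3) ^ 2 + b ^ 2 * (Y2 - Y3) ^ 2))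
    (e31 : (1 - X3 * X1 - Y3 * Y1) ^ 2 = k * (a ^ 2 * (X3 - X1) ^ 2 + b ^ 2 * (Y3 - Y1) ^ 2)) :
    ∃ m w1 w2 : ℝ, m = k * (a ^ 2 - b ^ 2) ∧ 4 * k * a ^ 2 = (3 - m) * (1 + m) ∧
      X1 + X2 + X3 = -m * w1 ∧
      X1 * X2 + X2 * X3 + X3 * X1 = (m - 3) * (m + 1) / 4 ∧
      X1 * X2 * X3 = (1 + m) ^ 2 / 4 * w1 ∧
      X1 ^ 2 - (1 - m) / 2 * w1 * X1 - (1 + m) / 2 * w2 * Y1 - (1 + m) / 2 = 0 ∧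
      X2 ^ 2 - (1 - m) / 2 * w1 * X2 - (1 + m) / 2 * w2 * Y2 - (1 + m) / 2 = 0 ∧
      X3 ^ 2 - (1 - m) / 2 * w1 * X3 - (1 + m) / 2 * w2 * Y3 - (1 + m) / 2 = 0 := by
  have b12 := bilinC _ _ _ _ _ _ _ h1 h2 (bilin a b k _ _ _ _ h1 h2 n12 e12)
  have b23 := bilinC _ _ _ _ _ _ _ h2 h3 (bilin a b k _ _ _ _ h2 h3 n23 e23)
  have b31 := bilinC _ _ _ _ _ _ _ h3 h1 (bilin a b k _ _ _ _ h3 h1 n31 e31)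
  have key : ∀ x y x' y' : ℝ, x ^ 2 + y ^ 2 = 1 → 1 - x * x' - y * y' ≠ 0 →
      (x : ℂ) + y * Complex.I ≠ (x' : ℂ) + y' * Complex.I := by
    intro x y x' y' hh hn he
    have hr := congrArg Complex.re he
    have hi := congrArg Complex.im he
    simp at hr hi
    subst hr hi
    exact hn (by linear_combination -hh)
  obtain ⟨s1, s2, s3⟩ := closing _ _ _ _ _ _ (key _ _ _ _ h1 n12) (key _ _ _ _ h2 n23)
    (key _ _ _ _ h3 n31) b12 b23 b31
  have s3' : 3 - 2 * k * (a ^ 2 + b ^ 2) - (k * (a ^ 2 - b ^ 2)) ^ 2 = 0 := by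
    exact_mod_cast s3
  obtain ⟨m, hm⟩ : ∃ m : ℝ, m = k * (a ^ 2 - b ^ 2) := ⟨_, rfl⟩
  have hmC : (k : ℂ) * ((a ^ 2 - b ^ 2 : ℝ) : ℂ) = (m : ℂ) := by rw [hm]; push_cast; ring
  rw [hmC] at s1 s2
  rw [← hm] at s3'
  have r1 := congrArg Complex.re s1
  have i1 := congrArg Complex.im s1
  have r2 := congrArg Complex.re s2
  have i2 := congrArg Complex.im s2
  simp at r1 i1 r2 i2
  refine ⟨m, (X1 * X2 - Y1 * Y2) * X3 - (X1 * Y2 + Y1 * X2) * Y3,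
    (X1 * X2 - Y1 * Y2) * Y3 + (X1 * Y2 + Y1 * X2) * X3, hm, ?_, ?_, ?_, ?_, ?_, ?_, ?_⟩
  · linear_combination -2 * hm - s3'
  · linear_combination r1
  · have hsq : (X1 + X2 + X3) ^ 2 + (Y1 + Y2 + Y3) ^ 2 = m ^ 2 := by
      have r1' : X1 + X2 + X3 = -m * ((X1 * X2 - Y1 * Y2) * X3 - (X1 * Y2 + Y1 * X2) * Y3) := by
        linear_combination r1
      have i1' : Y1 + Y2 + Y3 = -m * ((X1 * X2 - Y1 * Y2) * Y3 + (X1 * Y2 + Y1 * X2) * X3) := by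
        linear_combination i1
      have hw : ((X1 * X2 - Y1 * Y2) * X3 - (X1 * Y2 + Y1 * X2) * Y3) ^ 2 +
          ((X1 * X2 - Y1 * Y2) * Y3 + (X1 * Y2 + Y1 * X2) * X3) ^ 2 = 1 := by
        have : ((X1 * X2 - Y1 * Y2) * X3 - (X1 * Y2 + Y1 * X2) * Y3) ^ 2 +
          ((X1 * X2 - Y1 * Y2) * Y3 + (X1 * Y2 + Y1 * X2) * X3) ^ 2 =
          (X1 ^ 2 + Y1 ^ 2) * (X2 ^ 2 + Y2 ^ 2) * (X3 ^ 2 + Y3 ^ 2) := by ring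
        rw [this, h1, h2, h3]; ring
      rw [r1', i1']
      linear_combination m ^ 2 * hw
    linear_combination r2 / 2 + hsq / 4 - (h1 + h2 + h3) / 4
  · linear_combination ((X1 + X2 + X3) * r2 + (Y1 + Y2 + Y3) * i2
      - (X2 + X3) * h1 - (X1 + X3) * h2 - (X1 + X2) * h3 - (m + 2) * r1) / 4
  · linear_combination X1 / 2 * r1 - Y1 / 2 * i1 - r2 / 2 - (X2 * X3 - Y2 * Y3) / 2 * h1 + h1 / 2
  · linear_combination X2 / 2 * r1 - Y2 / 2 * i1 - r2 / 2 - (X1 * X3 - Y1 * Y3) / 2 * h2 + h2 / 2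
  · linear_combination X3 / 2 * r1 - Y3 / 2 * i1 - r2 / 2 - (X2 * X1 - Y2 * Y1) / 2 * h3 + h3 / 2

/-- Minus (twice the area) times (power of the point `(q,0)`). -/
def NN (q x1 y1 x2 y2 x3 y3 : ℝ) : ℝ :=
  ((x1 - q) * y2 - (x2 - q) * y1) * ((x3 - q) ^ 2 + y3 ^ 2) +
  ((x2 - q) * y3 - (x3 - q) * y2) * ((x1 - q) ^ 2 + y1 ^ 2) +
  ((x3 - q) * y1 - (x1 - q) * y3) * ((x2 - q) ^ 2 + y2 ^ 2)

/-- Twice the signed area. -/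
def WW (x1 y1 x2 y2 x3 y3 : ℝ) : ℝ :=
  (x2 - x1) * (y3 - y1) - (y2 - y1) * (x3 - x1)

lemma NN_eq (q x1 y1 x2 y2 x3 y3 D E F : ℝ)
    (h1 : x1 ^ 2 + y1 ^ 2 + D * x1 + E * y1 + F = 0)
    (h2 : x2 ^ 2 + y2 ^ 2 + D * x2 + E * y2 + F = 0)
    (h3 : x3 ^ 2 + y3 ^ 2 + D * x3 + E * y3 + F = 0) :
    NN q x1 y1 x2 y2 x3 y3 = -WW x1 y1 x2 y2 x3 y3 * (q ^ 2 + D * q + F) := by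
  unfold NN WW
  linear_combination ((x1 - q) * y2 - (x2 - q) * y1) * h3 +
    ((x2 - q) * y3 - (x3 - q) * y2) * h1 + ((x3 - q) * y1 - (x1 - q) * y3) * h2

/-- Foot of the perpendicular from the centre of inversion. -/
lemma foot (ρ q x1 y1 x2 y2 : ℝ) (hρ : ρ ≠ 0)
    (q1 : (x1 - q) ^ 2 + y1 ^ 2 ≠ 0) (q2 : (x2 - q) ^ 2 + y2 ^ 2 ≠ 0)
    (l : (x1 - x2) ^ 2 + (y1 - y2) ^ 2 ≠ 0) :
    projLine (q, 0) (inva ρ (q, 0) (x1, y1)) (inva ρ (q, 0) (x2, y2)) =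
     (q + ρ ^ 2 * (((x1 - q) * y2 - (x2 - q) * y1) / ((x1 - x2) ^ 2 + (y1 - y2) ^ 2)) *
        (y2 / ((x2 - q) ^ 2 + y2 ^ 2) - y1 / ((x1 - q) ^ 2 + y1 ^ 2)),
      -ρ ^ 2 * (((x1 - q) * y2 - (x2 - q) * y1) / ((x1 - x2) ^ 2 + (y1 - y2) ^ 2)) *
        ((x2 - q) / ((x2 - q) ^ 2 + y2 ^ 2) - (x1 - q) / ((x1 - q) ^ 2 + y1 ^ 2))) := by
  have e : dot (inva ρ (q, 0) (x2, y2) - inva ρ (q, 0) (x1, y1))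
      (inva ρ (q, 0) (x2, y2) - inva ρ (q, 0) (x1, y1)) =
      ρ ^ 4 * ((x1 - x2) ^ 2 + (y1 - y2) ^ 2) /
        (((x1 - q) ^ 2 + y1 ^ 2) * ((x2 - q) ^ 2 + y2 ^ 2)) := by
    simp only [dot, inva, Prod.fst_add, Prod.snd_add, Prod.fst_sub, Prod.snd_sub, Prod.smul_fst,
      Prod.smul_snd, smul_eq_mul, sub_zero, zero_add]
    field_simp
    ring
  unfold projLine
  rw [e]
  simp only [dot, inva, Prod.fst_add, Prod.snd_add, Prod.fst_sub, Prod.snd_sub, Prod.smul_fst,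
      Prod.smul_snd, smul_eq_mul, sub_zero, zero_add]
  ext
  · simp only [Prod.fst_add, Prod.snd_add, Prod.fst_sub, Prod.snd_sub, Prod.smul_fst,
      Prod.smul_snd, smul_eq_mul, sub_zero, zero_add]
    field_simp
    ring
  · simp only [Prod.fst_add, Prod.snd_add, Prod.fst_sub, Prod.snd_sub, Prod.smul_fst,
      Prod.smul_snd, smul_eq_mul, sub_zero, zero_add]
    field_simp
    ring

lemma pedal (ρ q x1 y1 x2 y2 x3 y3 : ℝ) (hρ : ρ ≠ 0)
    (q1 : (x1 - q) ^ 2 + y1 ^ 2 ≠ 0) (q2 : (x2 - q) ^ 2 + y2 ^ 2 ≠ 0)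
    (q3 : (x3 - q) ^ 2 + y3 ^ 2 ≠ 0)
    (l12 : (x1 - x2) ^ 2 + (y1 - y2) ^ 2 ≠ 0)
    (l23 : (x2 - x3) ^ 2 + (y2 - y3) ^ 2 ≠ 0)
    (l31 : (x3 - x1) ^ 2 + (y3 - y1) ^ 2 ≠ 0) :
    pedalArea (q, 0) (inva ρ (q, 0) (x1, y1)) (inva ρ (q, 0) (x2, y2)) (inva ρ (q, 0) (x3, y3)) =
    |ρ ^ 4 * WW x1 y1 x2 y2 x3 y3 / (((x1 - x2) ^ 2 + (y1 - y2) ^ 2) *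
        ((x2 - x3) ^ 2 + (y2 - y3) ^ 2) * ((x3 - x1) ^ 2 + (y3 - y1) ^ 2)) *
      (NN q x1 y1 x2 y2 x3 y3 ^ 2 / (((x1 - q) ^ 2 + y1 ^ 2) *
        ((x2 - q) ^ 2 + y2 ^ 2) * ((x3 - q) ^ 2 + y3 ^ 2)))| / 2 := by
  unfold pedalArea area
  rw [foot ρ q x1 y1 x2 y2 hρ q1 q2 l12, foot ρ q x2 y2 x3 y3 hρ q2 q3 l23,
    foot ρ q x3 y3 x1 y1 hρ q3 q1 l31]
  congr 2
  simp only []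
  have hs : ((x1 - q) * y2 - (x2 - q) * y1) * ((x2 - q) * y3 - (x3 - q) * y2) *
        ((x3 - x1) ^ 2 + (y3 - y1) ^ 2) +
      ((x2 - q) * y3 - (x3 - q) * y2) * ((x3 - q) * y1 - (x1 - q) * y3) *
        ((x1 - x2) ^ 2 + (y1 - y2) ^ 2) +
      ((x3 - q) * y1 - (x1 - q) * y3) * ((x1 - q) * y2 - (x2 - q) * y1) *
        ((x2 - x3) ^ 2 + (y2 - y3) ^ 2) =
      NN q x1 y1 x2 y2 x3 y3 * WW x1 y1 x2 y2 x3 y3 := by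
    unfold NN WW; ring
  have hN : NN q x1 y1 x2 y2 x3 y3 =
    ((x1 - q) * y2 - (x2 - q) * y1) * ((x3 - q) ^ 2 + y3 ^ 2) +
    ((x2 - q) * y3 - (x3 - q) * y2) * ((x1 - q) ^ 2 + y1 ^ 2) +
    ((x3 - q) * y1 - (x1 - q) * y3) * ((x2 - q) ^ 2 + y2 ^ 2) := rfl
  generalize NN q x1 y1 x2 y2 x3 y3 = N at *
  generalize WW x1 y1 x2 y2 x3 y3 = W at *
  generalize (x1 - x2) ^ 2 + (y1 - y2) ^ 2 = L12 at *
  generalize (x2 - x3) ^ 2 + (y2 - y3) ^ 2 = L23 at *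
  generalize (x3 - x1) ^ 2 + (y3 - y1) ^ 2 = L31 at *
  generalize (x1 - q) ^ 2 + y1 ^ 2 = Q1 at *
  generalize (x2 - q) ^ 2 + y2 ^ 2 = Q2 at *
  generalize (x3 - q) ^ 2 + y3 ^ 2 = Q3 at *
  generalize x1 - q = u1 at *
  generalize x2 - q = u2 at *
  generalize x3 - q = u3 at *
  have hs' : (u1 * y2 - u2 * y1) / L12 * ((u2 * y3 - u3 * y2) / L23) +
      (u2 * y3 - u3 * y2) / L23 * ((u3 * y1 - u1 * y3) / L31) +
      (u3 * y1 - u1 * y3) / L31 * ((u1 * y2 - u2 * y1) / L12) = N * W / (L12 * L23 * L31) := by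
    rw [← hs]; field_simp
  have hN' : (u1 / Q1 * (y2 / Q2) - u2 / Q2 * (y1 / Q1)) +
      (u2 / Q2 * (y3 / Q3) - u3 / Q3 * (y2 / Q2)) +
      (u3 / Q3 * (y1 / Q1) - u1 / Q1 * (y3 / Q3)) = N / (Q1 * Q2 * Q3) := by
    rw [hN]; field_simp
  have fin : ρ ^ 4 * W / (L12 * L23 * L31) * (N ^ 2 / (Q1 * Q2 * Q3)) =
      ρ ^ 4 * (N * W / (L12 * L23 * L31)) * (N / (Q1 * Q2 * Q3)) := by
    field_simp
  rw [fin, ← hs', ← hN']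
  ring

/-- Equality of the two ratios, in normalised coordinates. -/
lemma mainAlg (a b c k m w1 w2 X1 Y1 X2 Y2 X3 Y3 : ℝ) (ha : a ≠ 0) (hb : b ≠ 0)
    (hc : c ^ 2 = a ^ 2 - b ^ 2)
    (h1 : X1 ^ 2 + Y1 ^ 2 = 1) (h2 : X2 ^ 2 + Y2 ^ 2 = 1) (h3 : X3 ^ 2 + Y3 ^ 2 = 1)
    (hm : m = k * (a ^ 2 - b ^ 2)) (hk : 4 * k * a ^ 2 = (3 - m) * (1 + m))
    (s1 : X1 + X2 + X3 = -m * w1)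
    (s2 : X1 * X2 + X2 * X3 + X3 * X1 = (m - 3) * (m + 1) / 4)
    (s3 : X1 * X2 * X3 = (1 + m) ^ 2 / 4 * w1)
    (c1 : X1 ^ 2 - (1 - m) / 2 * w1 * X1 - (1 + m) / 2 * w2 * Y1 - (1 + m) / 2 = 0)
    (c2 : X2 ^ 2 - (1 - m) / 2 * w1 * X2 - (1 + m) / 2 * w2 * Y2 - (1 + m) / 2 = 0)
    (c3 : X3 ^ 2 - (1 - m) / 2 * w1 * X3 - (1 + m) / 2 * w2 * Y3 - (1 + m) / 2 = 0) :
    NN (-c) (a * X1) (b * Y1) (a * X2) (b * Y2) (a * X3) (b * Y3) *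
      ((a - c * X1) * (a - c * X2) * (a - c * X3)) =
    NN c (a * X1) (b * Y1) (a * X2) (b * Y2) (a * X3) (b * Y3) *
      ((a + c * X1) * (a + c * X2) * (a + c * X3)) := by
  have circ : ∀ X Y : ℝ, X ^ 2 + Y ^ 2 = 1 →
      X ^ 2 - (1 - m) / 2 * w1 * X - (1 + m) / 2 * w2 * Y - (1 + m) / 2 = 0 →
      (a * X) ^ 2 + (b * Y) ^ 2 + (-(c ^ 2 / (2 * a) * (1 - m) * w1)) * (a * X) +
        (-(c ^ 2 / (2 * b) * (1 + m) * w2)) * (b * Y) + (-b ^ 2 - c ^ 2 * (1 + m) / 2) = 0 := by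
    intro X Y h hh
    field_simp
    linear_combination 2 * c ^ 2 * hh + 2 * b ^ 2 * h - 2 * X ^ 2 * hc
  rw [NN_eq (-c) _ _ _ _ _ _ _ _ _ (circ _ _ h1 c1) (circ _ _ h2 c2) (circ _ _ h3 c3),
    NN_eq c _ _ _ _ _ _ _ _ _ (circ _ _ h1 c1) (circ _ _ h2 c2) (circ _ _ h3 c3)]
  have pm : (a - c * X1) * (a - c * X2) * (a - c * X3) =
      a ^ 3 * (1 - m) - w1 * (-m * a ^ 2 * c + c ^ 3 * (1 + m) ^ 2 / 4) := by
    linear_combination -a ^ 2 * c * s1 + a * c ^ 2 * s2 - c ^ 3 * s3 + a * c ^ 2 / 4 * hk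
      + a ^ 3 * hm - a ^ 3 * k * hc
  have pp : (a + c * X1) * (a + c * X2) * (a + c * X3) =
      a ^ 3 * (1 - m) + w1 * (-m * a ^ 2 * c + c ^ 3 * (1 + m) ^ 2 / 4) := by
    linear_combination a ^ 2 * c * s1 + a * c ^ 2 * s2 + c ^ 3 * s3 + a * c ^ 2 / 4 * hk
      + a ^ 3 * hm - a ^ 3 * k * hc
  rw [pm, pp]
  have hBC : (c ^ 3 / (2 * a) * (1 - m)) * (a ^ 3 * (1 - m)) =
      (c ^ 2 - b ^ 2 - c ^ 2 * (1 + m) / 2) * (-m * a ^ 2 * c + c ^ 3 * (1 + m) ^ 2 / 4) := by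
    have hk0 : k ≠ 0 := by
      rintro rfl
      rw [zero_mul] at hm
      rw [hm] at hk
      norm_num at hk
    have kc : 4 * k * c ^ 2 = 4 * m := by rw [hc, hm]; ring
    have kb : 4 * k * b ^ 2 = (3 + m) * (1 - m) := by
      linear_combination hk + 4 * hm
    have l : (c ^ 3 / (2 * a) * (1 - m)) * (a ^ 3 * (1 - m)) =
        c * (c ^ 2 * a ^ 2 * (1 - m) ^ 2 / 2) := by field_simp
    rw [l]
    apply mul_left_cancel₀ (mul_ne_zero (mul_ne_zero four_ne_zero hk0)
      (mul_ne_zero four_ne_zero hk0))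
    trans c * ((4 * k * c ^ 2) * (4 * k * a ^ 2) * (1 - m) ^ 2 / 2)
    · ring
    trans c * ((4 * k * c ^ 2 - 4 * k * b ^ 2 - 4 * k * c ^ 2 * (1 + m) / 2) *
      (-m * (4 * k * a ^ 2) + (4 * k * c ^ 2) * (1 + m) ^ 2 / 4))
    · rw [kc, kb, hk]; ring
    · ring
  linear_combination -2 * w1 * WW (a * X1) (b * Y1) (a * X2) (b * Y2) (a * X3) (b * Y3) * hBC

/-- The reflection law in normalised coordinates. -/
lemma refl_norm (a b : ℝ) (ha : a ≠ 0) (hb : b ≠ 0) (p q r : Pt)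
    (hq : onEllipse a b q) (h : reflectAt a b p q r) :
    (1 - q.1 / a * (p.1 / a) - q.2 / b * (p.2 / b)) / dst q p =
      (1 - q.1 / a * (r.1 / a) - q.2 / b * (r.2 / b)) / dst q r := by
  simp only [reflectAt, onEllipse, dot, udir, nrm, Prod.smul_fst, Prod.smul_snd, smul_eq_mul,
    Prod.fst_sub, Prod.snd_sub] at h hq
  have g : ∀ s : Pt, (1 - q.1 / a * (s.1 / a) - q.2 / b * (s.2 / b)) / dst q s =
      -((dst q s)⁻¹ * (s.1 - q.1) * (q.1 / a ^ 2) + (dst q s)⁻¹ * (s.2 - q.2) * (q.2 / b ^ 2)) := by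
    intro s
    rw [← hq]
    ring
  rw [g, g, h]

lemma dst_comm (p q : Pt) : dst p q = dst q p := by
  unfold dst; congr 1; ring

lemma dst_pos (p q : Pt) (h : p ≠ q) : 0 < (p.1 - q.1) ^ 2 + (p.2 - q.2) ^ 2 := by
  by_contra hn
  apply h
  have h1 : (p.1 - q.1) ^ 2 = 0 := by nlinarith [sq_nonneg (p.1 - q.1), sq_nonneg (p.2 - q.2)]
  have h2 : (p.2 - q.2) ^ 2 = 0 := by nlinarith [sq_nonneg (p.1 - q.1), sq_nonneg (p.2 - q.2)]
  ext
  · exact sub_eq_zero.mp (pow_eq_zero_iff two_ne_zero |>.mp h1)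
  · exact sub_eq_zero.mp (pow_eq_zero_iff two_ne_zero |>.mp h2)

lemma one_sub_ne (X1 Y1 X2 Y2 a b : ℝ) (h1 : X1 ^ 2 + Y1 ^ 2 = 1) (h2 : X2 ^ 2 + Y2 ^ 2 = 1)
    (h : 0 < (a * X1 - a * X2) ^ 2 + (b * Y1 - b * Y2) ^ 2) : 1 - X1 * X2 - Y1 * Y2 ≠ 0 := by
  intro h0
  have hx : (X1 - X2) ^ 2 = 0 := by nlinarith [sq_nonneg (X1 - X2), sq_nonneg (Y1 - Y2)]
  have hy : (Y1 - Y2) ^ 2 = 0 := by nlinarith [sq_nonneg (X1 - X2), sq_nonneg (Y1 - Y2)]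
  have : (a * X1 - a * X2) ^ 2 + (b * Y1 - b * Y2) ^ 2 =
    a ^ 2 * (X1 - X2) ^ 2 + b ^ 2 * (Y1 - Y2) ^ 2 := by ring
  rw [this, hx, hy] at h
  simp at h

/-- Squared focal distance. -/
lemma focal (a b c X Y : ℝ) (hc : c ^ 2 = a ^ 2 - b ^ 2) (h : X ^ 2 + Y ^ 2 = 1) :
    (a * X - c) ^ 2 + (b * Y) ^ 2 = (a - c * X) ^ 2 := by
  linear_combination (1 - X ^ 2) * hc + b ^ 2 * h

lemma focal_ne (a c X Y : ℝ) (hc : 0 ≤ c) (hca : c < a) (h : X ^ 2 + Y ^ 2 = 1) :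
    a - c * X ≠ 0 ∧ a + c * X ≠ 0 := by
  have h1 : X ≤ 1 := by nlinarith [sq_nonneg Y]
  have h2 : -1 ≤ X := by nlinarith [sq_nonneg Y]
  constructor <;> apply ne_of_gt <;> nlinarith

/-- The main statement in normalised coordinates. -/
lemma core (a b ρ c J X1 Y1 X2 Y2 X3 Y3 : ℝ) (ha : a ≠ 0) (hb : b ≠ 0) (hρ : ρ ≠ 0)
    (hc : c ^ 2 = a ^ 2 - b ^ 2) (hc0 : 0 ≤ c) (hca : c < a)
    (h1 : X1 ^ 2 + Y1 ^ 2 = 1) (h2 : X2 ^ 2 + Y2 ^ 2 = 1) (h3 : X3 ^ 2 + Y3 ^ 2 = 1)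
    (l12 : 0 < (a * X1 - a * X2) ^ 2 + (b * Y1 - b * Y2) ^ 2)
    (l23 : 0 < (a * X2 - a * X3) ^ 2 + (b * Y2 - b * Y3) ^ 2)
    (l31 : 0 < (a * X3 - a * X1) ^ 2 + (b * Y3 - b * Y1) ^ 2)
    (e12 : 1 - X1 * X2 - Y1 * Y2 = J * √((a * X1 - a * X2) ^ 2 + (b * Y1 - b * Y2) ^ 2))
    (e23 : 1 - X2 * X3 - Y2 * Y3 = J * √((a * X2 - a * X3) ^ 2 + (b * Y2 - b * Y3) ^ 2))
    (e31 : 1 - X3 * X1 - Y3 * Y1 = J * √((a * X3 - a * X1) ^ 2 + (b * Y3 - b * Y1) ^ 2)) :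
    pedalArea (-c, 0) (inva ρ (-c, 0) (a * X1, b * Y1)) (inva ρ (-c, 0) (a * X2, b * Y2))
        (inva ρ (-c, 0) (a * X3, b * Y3)) =
      pedalArea (c, 0) (inva ρ (c, 0) (a * X1, b * Y1)) (inva ρ (c, 0) (a * X2, b * Y2))
        (inva ρ (c, 0) (a * X3, b * Y3)) := by
  have sq : ∀ x y x' y' : ℝ, 0 < (a * x - a * x') ^ 2 + (b * y - b * y') ^ 2 →
      1 - x * x' - y * y' = J * √((a * x - a * x') ^ 2 + (b * y - b * y') ^ 2) →
      (1 - x * x' - y * y') ^ 2 = J ^ 2 * (a ^ 2 * (x - x') ^ 2 + b ^ 2 * (y - y') ^ 2) := by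
    intro x y x' y' hp he
    rw [he, mul_pow, Real.sq_sqrt hp.le]
    ring
  obtain ⟨m, w1, w2, hm, hk, s1, s2, s3, c1, c2, c3⟩ := realFacts a b (J ^ 2) X1 Y1 X2 Y2 X3 Y3
    h1 h2 h3 (one_sub_ne _ _ _ _ a b h1 h2 l12) (one_sub_ne _ _ _ _ a b h2 h3 l23)
    (one_sub_ne _ _ _ _ a b h3 h1 l31) (sq _ _ _ _ l12 e12) (sq _ _ _ _ l23 e23)
    (sq _ _ _ _ l31 e31)
  have M := mainAlg a b c (J ^ 2) m w1 w2 X1 Y1 X2 Y2 X3 Y3 ha hb hc h1 h2 h3 hm hk s1 s2 s3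
    c1 c2 c3
  have hc' : (-c) ^ 2 = a ^ 2 - b ^ 2 := by rw [← hc]; ring
  have fp := fun X Y h => focal a b c X Y hc h
  have fm : ∀ X Y : ℝ, X ^ 2 + Y ^ 2 = 1 → (a * X - -c) ^ 2 + (b * Y) ^ 2 = (a + c * X) ^ 2 := by
    intro X Y h
    rw [focal a b (-c) X Y hc' h]; ring
  obtain ⟨n1, p1⟩ := focal_ne a c X1 Y1 hc0 hca h1
  obtain ⟨n2, p2⟩ := focal_ne a c X2 Y2 hc0 hca h2
  obtain ⟨n3, p3⟩ := focal_ne a c X3 Y3 hc0 hca h3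
  rw [pedal ρ (-c) _ _ _ _ _ _ hρ (by rw [fm _ _ h1]; positivity) (by rw [fm _ _ h2]; positivity)
      (by rw [fm _ _ h3]; positivity) l12.ne' l23.ne' l31.ne',
    pedal ρ c _ _ _ _ _ _ hρ (by rw [fp _ _ h1]; positivity) (by rw [fp _ _ h2]; positivity)
      (by rw [fp _ _ h3]; positivity) l12.ne' l23.ne' l31.ne',
    fm _ _ h1, fm _ _ h2, fm _ _ h3, fp _ _ h1, fp _ _ h2, fp _ _ h3]
  congr 3
  rw [div_eq_div_iff (by positivity) (by positivity)]
  linear_combination (NN (-c) (a * X1) (b * Y1) (a * X2) (b * Y2) (a * X3) (b * Y3) *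
      ((a - c * X1) * (a - c * X2) * (a - c * X3)) +
    NN c (a * X1) (b * Y1) (a * X2) (b * Y2) (a * X3) (b * Y3) *
      ((a + c * X1) * (a + c * X2) * (a + c * X3))) * M

end FocusAux

/-- the areas of the pedal triangle of f₁ w.r.t. the f₁-inversive
triangle and of f₂ w.r.t. the f₂-inversive triangle are equal for every orbit. -/
theorem focus_inversive_pedal_areas_equal (a b ρ : ℝ) (hab : a > b) (hb : b > 0)
    (hρ : ρ > 0) (T : Orbit3 a b) :
    let c : ℝ := Real.sqrt (a ^ 2 - b ^ 2)
    let f1 : Pt := (-c, 0)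
    let f2 : Pt := (c, 0)
    pedalArea f1 (inva ρ f1 T.P1) (inva ρ f1 T.P2) (inva ρ f1 T.P3) =
      pedalArea f2 (inva ρ f2 T.P1) (inva ρ f2 T.P2) (inva ρ f2 T.P3) := by
  obtain ⟨⟨x1, y1⟩, ⟨x2, y2⟩, ⟨x3, y3⟩, h1, h2, h3, d12, d23, d31, r1, r2, r3⟩ := T
  intro c f1 f2
  have ha0 : 0 < a := hb.trans hab
  have ha : a ≠ 0 := ha0.ne'
  have hb' : b ≠ 0 := hb.ne'
  have t1 := FocusAux.refl_norm a b ha hb' _ _ _ h1 r1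
  have t2 := FocusAux.refl_norm a b ha hb' _ _ _ h2 r2
  have t3 := FocusAux.refl_norm a b ha hb' _ _ _ h3 r3
  have l12 := FocusAux.dst_pos _ _ d12
  have l23 := FocusAux.dst_pos _ _ d23
  have l31 := FocusAux.dst_pos _ _ d31
  rw [FocusAux.dst_comm (x1, y1) (x3, y3)] at t1
  rw [FocusAux.dst_comm (x2, y2) (x1, y1)] at t2
  rw [FocusAux.dst_comm (x3, y3) (x2, y2)] at t3
  have hc : c ^ 2 = a ^ 2 - b ^ 2 := Real.sq_sqrt (by nlinarith)
  have hc0 : 0 ≤ c := Real.sqrt_nonneg _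
  have hca : c < a := by nlinarith
  obtain ⟨X1, rfl⟩ : ∃ X, x1 = a * X := ⟨x1 / a, by field_simp⟩
  obtain ⟨X2, rfl⟩ : ∃ X, x2 = a * X := ⟨x2 / a, by field_simp⟩
  obtain ⟨X3, rfl⟩ : ∃ X, x3 = a * X := ⟨x3 / a, by field_simp⟩
  obtain ⟨Y1, rfl⟩ : ∃ Y, y1 = b * Y := ⟨y1 / b, by field_simp⟩
  obtain ⟨Y2, rfl⟩ : ∃ Y, y2 = b * Y := ⟨y2 / b, by field_simp⟩
  obtain ⟨Y3, rfl⟩ : ∃ Y, y3 = b * Y := ⟨y3 / b, by field_simp⟩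
  have ell : ∀ X Y : ℝ, onEllipse a b (a * X, b * Y) → X ^ 2 + Y ^ 2 = 1 := by
    intro X Y h
    simp only [onEllipse] at h
    rw [← h]
    field_simp
  have s12 := Real.sqrt_pos.mpr l12
  have s23 := Real.sqrt_pos.mpr l23
  have s31 := Real.sqrt_pos.mpr l31
  simp only [dst, mul_div_cancel_left₀ _ ha, mul_div_cancel_left₀ _ hb'] at t1 t2 t3 l12 l23 l31 s12 s23 s31
  refine FocusAux.core a b ρ c ((1 - X1 * X2 - Y1 * Y2) /
    √((a * X1 - a * X2) ^ 2 + (b * Y1 - b * Y2) ^ 2)) X1 Y1 X2 Y2 X3 Y3 ha hb' hρ.ne' hc hc0 hca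
    (ell _ _ h1) (ell _ _ h2) (ell _ _ h3) l12 l23 l31 ?_ ?_ ?_
  · rw [div_mul_cancel₀ _ s12.ne']
  · rw [← div_eq_iff s23.ne', ← t2]
    ring
  · rw [← div_eq_iff s31.ne', ← t1]
    ring
end
end

section
/- Over the 3-periodic billiard family, the barycenter X₂† of the focus-inversive triangle lies on the circle with center C₂† = (−c(1 + ρ²(2a² − b² − δ)/(3a²b²)), 0) and radius R₂† = ρ²(2a² − b² − δ)/(3ab²). -/
noncomputable section

lemma vieta_aux (q C : ℂ) (z1 z2 z3 : ℂ) (h1 : z1 ≠ 0)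
    (h12 : z1 ≠ z2) (h23 : z2 ≠ z3) (h31 : z3 ≠ z1)
    (e12 : -q * (z1^2*z2^2+1) + (z1^2+z2^2) = 2*C*(z1*z2))
    (e23 : -q * (z2^2*z3^2+1) + (z2^2+z3^2) = 2*C*(z2*z3))
    (e31 : -q * (z3^2*z1^2+1) + (z3^2+z1^2) = 2*C*(z3*z1)) :
    z1+z2+z3 = -q*(z1*z2*z3) ∧ z1*z2+z2*z3+z3*z1 = -q ∧ 2*C = q^2-1 := by
  have s1 : (1-q*z1^2)*(z2+z3) = 2*C*z1 := by
    apply mul_left_cancel₀ (sub_ne_zero.2 h23); linear_combination e12 - e31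
  have s2 : (1-q*z2^2)*(z1+z3) = 2*C*z2 := by
    apply mul_left_cancel₀ (sub_ne_zero.2 h31); linear_combination e23 - e12
  have s3 : (1-q*z3^2)*(z2+z1) = 2*C*z3 := by
    apply mul_left_cancel₀ (sub_ne_zero.2 h12); linear_combination e31 - e23
  have p1 : (1-q*z1^2)*(z1*z2*z3) = z1^3-q*z1 := by
    linear_combination z1*z2*s1 - z1*e12
  have p2 : (1-q*z2^2)*(z1*z2*z3) = z2^3-q*z2 := by
    linear_combination z2*z3*s2 - z2*e23
  have p3 : (1-q*z3^2)*(z1*z2*z3) = z3^3-q*z3 := by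
    linear_combination z3*z1*s3 - z3*e31
  have d12 : z1^2+z1*z2+z2^2+q*(z1*z2*z3)*(z1+z2)-q = 0 := by
    apply mul_left_cancel₀ (sub_ne_zero.2 h12); linear_combination p2 - p1
  have d31 : z1^2+z1*z3+z3^2+q*(z1*z2*z3)*(z1+z3)-q = 0 := by
    apply mul_left_cancel₀ (sub_ne_zero.2 h31); linear_combination p1 - p3
  have t1 : z1+z2+z3 = -q*(z1*z2*z3) := by
    apply mul_left_cancel₀ (sub_ne_zero.2 h23); linear_combination d12 - d31
  refine ⟨t1, ?_, ?_⟩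
  · linear_combination -d12 + (z1+z2)*t1
  · apply mul_left_cancel₀ h1
    linear_combination -s1 + (1-q*z1^2)*t1 - q * p1

lemma key_aux (q m E : ℂ) (rel : m^2*q^2+q*(1+m^4)-3*m^2 = 0) :
    (1+m^2)^2*(1-m^2)^2*(-q*E - 4*m*q + m^2*(q^2+9)*E - 4*m^3*q*E^2 - m^4*q*E)
      + 4*m^3*(3-q)*(1-q*m^2+m*(m^2-q)*E)^2
      = 2*m^2*(3-q)*(1+m^2)*(m*(m^2-q)+(1-q*m^2)*E)*(1-q*m^2+m*(m^2-q)*E) := by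
    grind

lemma sum_aux (q m : ℂ) (z1 z2 z3 : ℂ)
    (t1 : z1+z2+z3 = -q*(z1*z2*z3)) (t2 : z1*z2+z2*z3+z3*z1 = -q)
    (rel : m^2*q^2+q*(1+m^4)-3*m^2 = 0)
    (n1 : 1+m*z1 ≠ 0) (n2 : 1+m*z2 ≠ 0) (n3 : 1+m*z3 ≠ 0) :
    (1+m^2)^2*(1-m^2)^2*(z1/(1+m*z1)^2+z2/(1+m*z2)^2+z3/(1+m*z3)^2)
      + 4*m^3*(3-q)
     = 2*m^2*(3-q)*(1+m^2)*((m*(m^2-q)+(1-q*m^2)*(z1*z2*z3))/(1-q*m^2+m*(m^2-q)*(z1*z2*z3))) := by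
  obtain ⟨E, hE⟩ : ∃ E, E = z1*z2*z3 := ⟨_, rfl⟩
  have hD : (1+m*z1)*(1+m*z2)*(1+m*z3) = 1-q*m^2+m*(m^2-q)*E := by
    rw [hE]; linear_combination m*t1+m^2*t2
  have hD0 : 1-q*m^2+m*(m^2-q)*E ≠ 0 := by
    rw [← hD]; exact mul_ne_zero (mul_ne_zero n1 n2) n3
  have hN : z1/(1+m*z1)^2+z2/(1+m*z2)^2+z3/(1+m*z3)^2
      = (-q*E - 4*m*q + m^2*(q^2+9)*E - 4*m^3*q*E^2 - m^4*q*E)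
        / (1-q*m^2+m*(m^2-q)*E)^2 := by
    have hP : z1*(1+m*z2)^2*(1+m*z3)^2 + z2*(1+m*z1)^2*(1+m*z3)^2 + z3*(1+m*z1)^2*(1+m*z2)^2
        = -q*E - 4*m*q + m^2*(q^2+9)*E - 4*m^3*q*E^2 - m^4*q*E := by
      rw [← hE] at t1
      have : z1*(1+m*z2)^2*(1+m*z3)^2 + z2*(1+m*z1)^2*(1+m*z3)^2 + z3*(1+m*z1)^2*(1+m*z2)^2
        = (z1+z2+z3) + 4*m*(z1*z2+z2*z3+z3*z1)
          + m^2*((z1+z2+z3)*(z1*z2+z2*z3+z3*z1)+9*(z1*z2*z3))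
          + 4*m^3*((z1*z2*z3)*(z1+z2+z3)) + m^4*((z1*z2*z3)*(z1*z2+z2*z3+z3*z1)) := by ring
      rw [this, t1, t2, ← hE]; ring
    rw [← hP, ← hD]
    clear hP hD hD0
    generalize 1+m*z1 = u1 at *
    generalize 1+m*z2 = u2 at *
    generalize 1+m*z3 = u3 at *
    field_simp
  rw [hN, ← hE]
  have key := key_aux q m E rel
  generalize 1-q*m^2+m*(m^2-q)*E = D at *
  field_simp
  linear_combination key

lemma norm_aux (u v : ℝ) (E : ℂ) (hE : ‖E‖ = 1) (h : (u:ℂ) + v*E ≠ 0) :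
    ‖((v:ℂ) + u*E) / (u + v*E)‖ = 1 := by
  rw [norm_div, div_eq_one_iff_eq (norm_ne_zero_iff.2 h)]
  have h2 : E.re^2+E.im^2 = 1 := by
    have := Complex.sq_norm E
    rw [hE, Complex.normSq_apply] at this; linarith
  rw [← sq_eq_sq₀ (norm_nonneg _) (norm_nonneg _), Complex.sq_norm, Complex.sq_norm,
    Complex.normSq_apply, Complex.normSq_apply]
  simp
  linear_combination (u^2-v^2)*h2

/-- quadrant relation for a pair -/
lemma pair_rel_s13 (a b j x1 y1 x2 y2 : ℝ) (h1 : x1^2+y1^2=1) (h2 : x2^2+y2^2=1)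
    (hne : 1-(x1*x2+y1*y2) ≠ 0)
    (h : (1-(x1*x2+y1*y2))^2 = j*(a^2*(x1-x2)^2+b^2*(y1-y2)^2)) :
    1-(x1*x2+y1*y2) = j*(a^2*(1-x1*x2+y1*y2)+b^2*(1+x1*x2-y1*y2)) := by
  apply mul_left_cancel₀ hne
  have e1 : (x1-x2)^2 = (1-(x1*x2+y1*y2))*(1-x1*x2+y1*y2) := by
    have : (y1*y2)^2 = (1-x1^2)*(1-x2^2) := by
      rw [show 1-x1^2 = y1^2 by linarith, show 1-x2^2 = y2^2 by linarith]; ring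
    linear_combination this
  have e2 : (y1-y2)^2 = (1-(x1*x2+y1*y2))*(1+x1*x2-y1*y2) := by
    have : (x1*x2)^2 = (1-y1^2)*(1-y2^2) := by
      rw [show 1-y1^2 = x1^2 by linarith, show 1-y2^2 = x2^2 by linarith]; ring
    linear_combination this
  rw [e1, e2] at h
  linear_combination h

lemma cpair (q C x1 y1 x2 y2 : ℝ) (h1 : x1^2+y1^2=1) (h2 : x2^2+y2^2=1)
    (h : (1-q)*(x1*x2)+(1+q)*(y1*y2) = C) :
    -(q:ℂ) * ((⟨x1,y1⟩:ℂ)^2*(⟨x2,y2⟩:ℂ)^2+1) + ((⟨x1,y1⟩:ℂ)^2+(⟨x2,y2⟩:ℂ)^2)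
      = 2*C*((⟨x1,y1⟩:ℂ)*(⟨x2,y2⟩:ℂ)) := by
  have k1 : (⟨x1,y1⟩:ℂ)*⟨x1,-y1⟩ = 1 := by
    apply Complex.ext
    · simp; linear_combination h1
    · simp; ring
  have k2 : (⟨x2,y2⟩:ℂ)*⟨x2,-y2⟩ = 1 := by
    apply Complex.ext
    · simp; linear_combination h2
    · simp; ring
  have k3 : -(q:ℂ)*((⟨x1,y1⟩:ℂ)*⟨x2,y2⟩+(⟨x1,-y1⟩:ℂ)*⟨x2,-y2⟩)
      + ((⟨x1,y1⟩:ℂ)*⟨x2,-y2⟩+(⟨x1,-y1⟩:ℂ)*⟨x2,y2⟩) = 2*C := by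
    rw [← h]
    apply Complex.ext <;> simp <;> ring
  rw [← k3]
  generalize (⟨x1,y1⟩:ℂ) = z1 at *
  generalize (⟨x2,y2⟩:ℂ) = z2 at *
  generalize (⟨x1,-y1⟩:ℂ) = w1 at *
  generalize (⟨x2,-y2⟩:ℂ) = w2 at *
  linear_combination (q*z2*w2-z2^2)*k1+(q-z1^2)*k2

lemma inv_term (k m x y : ℝ) (h : x^2+y^2=1) (hk : k ≠ 0)
   (hd : k*(1+m^2)+2*k*m*x ≠ 0) (hz : 1+(m:ℂ)*⟨x,y⟩ ≠ 0) :
   (⟨x,y⟩:ℂ)/(1+m*⟨x,y⟩)^2 = k *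
    ⟨(k*(1+m^2)*x+2*k*m)/(k*(1+m^2)+2*k*m*x)^2, (k*(1-m^2)*y)/(k*(1+m^2)+2*k*m*x)^2⟩ := by
  have k1 : (⟨x,y⟩:ℂ)*⟨x,-y⟩ = 1 := by
    apply Complex.ext
    · simp; linear_combination h
    · simp; ring
  have e0 : ∀ p r D : ℝ, (⟨p/D^2, r/D^2⟩:ℂ) = ⟨p,r⟩/(D:ℂ)^2 := by
    intro p r D
    rw [← Complex.ofReal_pow]
    apply Complex.ext
    · rw [Complex.div_ofReal_re]
    · rw [Complex.div_ofReal_im]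
  have e1 : (⟨k*(1+m^2)*x+2*k*m, k*(1-m^2)*y⟩:ℂ) = k*(⟨x,y⟩+2*m+m^2*⟨x,-y⟩) := by
    apply Complex.ext
    · simp [pow_two]; ring
    · simp [pow_two]; ring
  have e : (⟨(k*(1+m^2)*x+2*k*m)/(k*(1+m^2)+2*k*m*x)^2,
      (k*(1-m^2)*y)/(k*(1+m^2)+2*k*m*x)^2⟩:ℂ)
     = k*⟨x,-y⟩*(⟨x,y⟩+m)^2/((k*(1+m^2)+2*k*m*x:ℝ):ℂ)^2 := by
    rw [e0, e1]
    congr 1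
    linear_combination (-(k:ℂ)*⟨x,y⟩-2*k*m)*k1
  have f : ((k*(1+m^2)+2*k*m*x:ℝ):ℂ) = k*(1+m*⟨x,y⟩)*(1+m*⟨x,-y⟩) := by
    apply Complex.ext
    · simp [pow_two]; linear_combination -k*m^2*h
    · simp [pow_two]; ring
  have hd' : ((k*(1+m^2)+2*k*m*x:ℝ):ℂ) ≠ 0 := by exact_mod_cast hd
  rw [e]
  rw [f] at hd' ⊢
  generalize (⟨x,y⟩:ℂ) = z at *
  generalize (⟨x,-y⟩:ℂ) = w at *
  have hw : 1+m*w ≠ 0 := right_ne_zero_of_mul hd'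
  have hk' : (k:ℂ) ≠ 0 := by exact_mod_cast hk
  have : z+m = z*(1+m*w) := by linear_combination -(m:ℂ)*k1
  rw [this]
  generalize 1+m*w = u at *
  generalize 1+m*z = v at *
  field_simp
  linear_combination -z*k1

lemma norm_mk (x y : ℝ) (h : x^2+y^2=1) : ‖(⟨x,y⟩:ℂ)‖ = 1 := by
  rw [← sq_eq_sq₀ (norm_nonneg _) zero_le_one, Complex.sq_norm, Complex.normSq_apply]
  simp only []; linarith

lemma one_add_ne (m : ℝ) (h0 : 0 < m) (h1 : m < 1) (z : ℂ) (hz : ‖z‖ = 1) :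
    1 + (m:ℂ)*z ≠ 0 := by
  intro h
  have h2 : (m:ℂ)*z = -1 := by linear_combination h
  have h3 := congrArg norm h2
  rw [norm_mul, hz, norm_neg, norm_one, Complex.norm_real, Real.norm_of_nonneg h0.le] at h3
  linarith

lemma core_aux (a b c k m q x1 y1 x2 y2 x3 y3 : ℝ) (hk : 0 < k) (hm0 : 0 < m) (hm1 : m < 1)
    (ha : a = k*(1+m^2)) (hb : b = k*(1-m^2)) (hc : c = 2*k*m)
    (h1 : x1^2+y1^2=1) (h2 : x2^2+y2^2=1) (h3 : x3^2+y3^2=1)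
    (t1 : (⟨x1,y1⟩:ℂ)+⟨x2,y2⟩+⟨x3,y3⟩ = -q*(⟨x1,y1⟩*⟨x2,y2⟩*⟨x3,y3⟩))
    (t2 : (⟨x1,y1⟩:ℂ)*⟨x2,y2⟩+⟨x2,y2⟩*⟨x3,y3⟩+⟨x3,y3⟩*⟨x1,y1⟩ = -q)
    (rel : m^2*q^2+q*(1+m^4)-3*m^2 = 0) (hq : q < 3) :
    ((a*x1+c)/(a+c*x1)^2+(a*x2+c)/(a+c*x2)^2+(a*x3+c)/(a+c*x3)^2
        + c*(c^2*(3-q)/(2*a^2*b^2)))^2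
      + (b*y1/(a+c*x1)^2+b*y2/(a+c*x2)^2+b*y3/(a+c*x3)^2)^2
      = (a*(c^2*(3-q)/(2*a^2*b^2)))^2 := by
  have n1 := one_add_ne m hm0 hm1 _ (norm_mk _ _ h1)
  have n2 := one_add_ne m hm0 hm1 _ (norm_mk _ _ h2)
  have n3 := one_add_ne m hm0 hm1 _ (norm_mk _ _ h3)
  have hd : ∀ x y : ℝ, x^2+y^2=1 → k*(1+m^2)+2*k*m*x ≠ 0 := by
    intro x y h
    have hx : -1 ≤ x := by nlinarith [sq_nonneg y]
    have : 0 < (1-m)^2 := by apply pow_pos; linarith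
    have h5 : 0 < (1-m)^2 + 2*m*(1+x) := by nlinarith
    have : k*(1+m^2)+2*k*m*x = k*((1-m)^2 + 2*m*(1+x)) := by ring
    rw [this]; positivity
  have S := sum_aux q m _ _ _ t1 t2 (by exact_mod_cast rel) n1 n2 n3
  rw [inv_term k m x1 y1 h1 hk.ne' (hd _ _ h1) n1, inv_term k m x2 y2 h2 hk.ne' (hd _ _ h2) n2,
    inv_term k m x3 y3 h3 hk.ne' (hd _ _ h3) n3, ← ha, ← hb, ← hc] at S
  have hE : ‖(⟨x1,y1⟩:ℂ)*⟨x2,y2⟩*⟨x3,y3⟩‖ = 1 := by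
    rw [norm_mul, norm_mul, norm_mk _ _ h1, norm_mk _ _ h2, norm_mk _ _ h3]; norm_num
  have hD : ((1-q*m^2:ℝ):ℂ)+((m*(m^2-q):ℝ):ℂ)*((⟨x1,y1⟩:ℂ)*⟨x2,y2⟩*⟨x3,y3⟩) ≠ 0 := by
    have : ((1-q*m^2:ℝ):ℂ)+((m*(m^2-q):ℝ):ℂ)*((⟨x1,y1⟩:ℂ)*⟨x2,y2⟩*⟨x3,y3⟩)
      = (1+m*⟨x1,y1⟩)*(1+m*⟨x2,y2⟩)*(1+m*⟨x3,y3⟩) := by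
      push_cast
      linear_combination -m*t1-m^2*t2
    rw [this]; exact mul_ne_zero (mul_ne_zero n1 n2) n3
  have hU := norm_aux _ _ _ hE hD
  push_cast at hU
  generalize (((m:ℂ) * (m ^ 2 - q) + (1 - q * m ^ 2) * ((⟨x1,y1⟩:ℂ)*⟨x2,y2⟩*⟨x3,y3⟩)) /
    (1 - q * m ^ 2 + m * (m ^ 2 - q) * ((⟨x1,y1⟩:ℂ)*⟨x2,y2⟩*⟨x3,y3⟩))) = U at *
  have hm2 : 1 - m^2 ≠ 0 := by nlinarith
  have hm3 : 1 + m^2 ≠ 0 := by positivity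
  have V : ((⟨(a*x1+c)/(a+c*x1)^2+(a*x2+c)/(a+c*x2)^2+(a*x3+c)/(a+c*x3)^2
        + c*(c^2*(3-q)/(2*a^2*b^2)), b*y1/(a+c*x1)^2+b*y2/(a+c*x2)^2+b*y3/(a+c*x3)^2⟩:ℂ))
        = ((a*(c^2*(3-q)/(2*a^2*b^2)):ℝ):ℂ) * U := by
    have e1 : ∀ p1 p2 p3 r s1 s2 s3 : ℝ, (⟨p1+p2+p3+r, s1+s2+s3⟩:ℂ)
        = ⟨p1,s1⟩+⟨p2,s2⟩+⟨p3,s3⟩+(r:ℂ) := by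
      intros; apply Complex.ext <;> simp
    rw [e1]
    have f1 : c*(c^2*(3-q)/(2*a^2*b^2)) * (k*(1+m^2)^2*(1-m^2)^2) = 4*m^3*(3-q) := by
      rw [ha, hb, hc]; field_simp; ring
    have f2 : a*(c^2*(3-q)/(2*a^2*b^2)) * (k*(1+m^2)^2*(1-m^2)^2) = 2*m^2*(3-q)*(1+m^2) := by
      rw [ha, hb, hc]; field_simp
    have f3 : ((k*(1+m^2)^2*(1-m^2)^2:ℝ):ℂ) ≠ 0 := by
      exact_mod_cast mul_ne_zero (mul_ne_zero hk.ne' (pow_ne_zero 2 hm3)) (pow_ne_zero 2 hm2)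
    generalize c*(c^2*(3-q)/(2*a^2*b^2)) = r1 at *
    generalize a*(c^2*(3-q)/(2*a^2*b^2)) = r2 at *
    have f1' := congrArg (fun t : ℝ => (t:ℂ)) f1
    have f2' := congrArg (fun t : ℝ => (t:ℂ)) f2
    apply mul_left_cancel₀ f3
    push_cast at f1' f2' ⊢
    linear_combination S + f1' - U*f2'
  generalize a*(c^2*(3-q)/(2*a^2*b^2)) = r2 at V ⊢
  have N := congrArg (fun t => ‖t‖^2) V
  simp only [norm_mul, hU, mul_one, Complex.norm_real, Real.norm_eq_abs, sq_abs] at N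
  rw [Complex.sq_norm, Complex.normSq_apply] at N
  simp only [] at N
  rw [← N]; ring

lemma refl_val (a b : ℝ) (ha : 0 < a) (hb : 0 < b) (v q : BilliardInv.Pt)
    (h : BilliardInv.onEllipse a b v) :
    BilliardInv.dot (BilliardInv.udir v q) (BilliardInv.nrm a b v)
      = -((1-(v.1/a*(q.1/a)+v.2/b*(q.2/b)))/BilliardInv.dst v q) := by
  unfold BilliardInv.onEllipse at h
  simp only [BilliardInv.dot, BilliardInv.udir, BilliardInv.nrm, Prod.smul_fst, Prod.smul_snd,
    Prod.fst_sub, Prod.snd_sub, smul_eq_mul]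
  rw [← h]
  generalize BilliardInv.dst v q = d
  field_simp
  ring

lemma dst_symm (v q : BilliardInv.Pt) : BilliardInv.dst v q = BilliardInv.dst q v := by
  unfold BilliardInv.dst; congr 1; ring

lemma ell_unit (a b : ℝ) (v : BilliardInv.Pt) (h : BilliardInv.onEllipse a b v) :
    (v.1/a)^2+(v.2/b)^2 = 1 := by
  unfold BilliardInv.onEllipse at h
  rw [div_pow, div_pow]; exact h

lemma pt_ne (a b : ℝ) (ha : 0 < a) (hb : 0 < b) (v q : BilliardInv.Pt) (hne : v ≠ q) :
    ¬ (v.1/a = q.1/a ∧ v.2/b = q.2/b) := by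
  rintro ⟨h1, h2⟩
  exact hne (Prod.ext ((div_left_inj' ha.ne').1 h1) ((div_left_inj' hb.ne').1 h2))

lemma pair_main (a b G : ℝ) (ha : 0 < a) (hb : 0 < b) (v q : BilliardInv.Pt)
    (hv : BilliardInv.onEllipse a b v) (hq : BilliardInv.onEllipse a b q) (hne : v ≠ q)
    (hG : (1-(v.1/a*(q.1/a)+v.2/b*(q.2/b)))/BilliardInv.dst v q = G) :
    (1-G^2*(a^2-b^2))*(v.1/a*(q.1/a))+(1+G^2*(a^2-b^2))*(v.2/b*(q.2/b))
      = 1-G^2*(a^2+b^2) := by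
  have h1 := ell_unit a b v hv
  have h2 := ell_unit a b q hq
  have hn := pt_ne a b ha hb v q hne
  have hd : BilliardInv.dst v q ^2 = a^2*(v.1/a-q.1/a)^2+b^2*(v.2/b-q.2/b)^2 := by
    unfold BilliardInv.dst
    rw [Real.sq_sqrt (by positivity)]
    field_simp
  generalize BilliardInv.dst v q = d at *
  generalize v.1/a = x1 at *
  generalize v.2/b = y1 at *
  generalize q.1/a = x2 at *
  generalize q.2/b = y2 at *
  have hc : 1-(x1*x2+y1*y2) ≠ 0 := by
    intro h0
    apply hn
    have : (x1-x2)^2+(y1-y2)^2 = 0 := by linear_combination h1+h2+2*h0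
    constructor
    · nlinarith [sq_nonneg (x1-x2), sq_nonneg (y1-y2)]
    · nlinarith [sq_nonneg (x1-x2), sq_nonneg (y1-y2)]
  have hd0 : d ≠ 0 := by
    rintro rfl
    apply hn
    have e1 : 0 ≤ a^2*(x1-x2)^2 := by positivity
    have e2 : 0 ≤ b^2*(y1-y2)^2 := by positivity
    have e3 : a^2*(x1-x2)^2 = 0 := by linarith
    have e4 : b^2*(y1-y2)^2 = 0 := by linarith
    constructor
    · have := (mul_eq_zero.1 e3).resolve_left (by positivity)
      exact sub_eq_zero.1 (pow_eq_zero_iff (two_ne_zero)|>.1 this)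
    · have := (mul_eq_zero.1 e4).resolve_left (by positivity)
      exact sub_eq_zero.1 (pow_eq_zero_iff (two_ne_zero)|>.1 this)
  rw [div_eq_iff hd0] at hG
  have := pair_rel_s13 a b (G^2) x1 y1 x2 y2 h1 h2 hc (by rw [hG, ← hd]; ring)
  linear_combination -this

open BilliardInv Real

set_option maxHeartbeats 1000000 in
/-- over the 3-periodic billiard family, the barycenter X(2) of the
focus-inversive triangle lies on the stated circle. -/
theorem focus_inversive_centroid_circle (a b ρ : ℝ) (hab : a > b) (hb : b > 0)
    (hρ : ρ > 0) (T : Orbit3 a b) :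
    let c : ℝ := Real.sqrt (a ^ 2 - b ^ 2)
    let δ : ℝ := Real.sqrt (a ^ 4 - a ^ 2 * b ^ 2 + b ^ 4)
    let f1 : Pt := (-c, 0)
    let Ctr : Pt := (-c * (1 + ρ ^ 2 * (2 * a ^ 2 - b ^ 2 - δ) / (3 * a ^ 2 * b ^ 2)), 0)
    dst (centroid (inva ρ f1 T.P1) (inva ρ f1 T.P2) (inva ρ f1 T.P3)) Ctr =
      ρ ^ 2 * (2 * a ^ 2 - b ^ 2 - δ) / (3 * a * b ^ 2) := by
  intro c δ f1 Ctr
  have ha : 0 < a := by linarith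
  have hc2 : c^2 = a^2-b^2 := Real.sq_sqrt (by nlinarith)
  have hc : 0 < c := Real.sqrt_pos.2 (by nlinarith)
  have R1 := T.r1
  have R2 := T.r2
  unfold reflectAt at R1 R2
  rw [refl_val a b ha hb _ _ T.h1, refl_val a b ha hb _ _ T.h1, neg_inj] at R1
  rw [refl_val a b ha hb _ _ T.h2, refl_val a b ha hb _ _ T.h2, neg_inj] at R2
  obtain ⟨G, hG⟩ : ∃ G, (1-(T.P1.1/a*(T.P2.1/a)+T.P1.2/b*(T.P2.2/b)))/dst T.P1 T.P2 = G :=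
    ⟨_, rfl⟩
  have hG31 : (1-(T.P3.1/a*(T.P1.1/a)+T.P3.2/b*(T.P1.2/b)))/dst T.P3 T.P1 = G := by
    rw [← hG, ← R1, dst_symm T.P3 T.P1, mul_comm (T.P3.1/a), mul_comm (T.P3.2/b)]
  have hG23 : (1-(T.P2.1/a*(T.P3.1/a)+T.P2.2/b*(T.P3.2/b)))/dst T.P2 T.P3 = G := by
    rw [← R2, ← hG, dst_symm T.P2 T.P1, mul_comm (T.P2.1/a), mul_comm (T.P2.2/b)]
  have q12 := pair_main a b G ha hb _ _ T.h1 T.h2 T.d12 hG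
  have q23 := pair_main a b G ha hb _ _ T.h2 T.h3 T.d23 hG23
  have q31 := pair_main a b G ha hb _ _ T.h3 T.h1 T.d31 hG31
  have u1 := ell_unit a b _ T.h1
  have u2 := ell_unit a b _ T.h2
  have u3 := ell_unit a b _ T.h3
  have ne12 := pt_ne a b ha hb _ _ T.d12
  have ne23 := pt_ne a b ha hb _ _ T.d23
  have ne31 := pt_ne a b ha hb _ _ T.d31
  clear R1 R2 hG hG31 hG23
  -- normalised coordinates
  obtain ⟨x1, hx1⟩ : ∃ x, x = T.P1.1/a := ⟨_, rfl⟩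
  obtain ⟨x2, hx2⟩ : ∃ x, x = T.P2.1/a := ⟨_, rfl⟩
  obtain ⟨x3, hx3⟩ : ∃ x, x = T.P3.1/a := ⟨_, rfl⟩
  obtain ⟨y1, hy1⟩ : ∃ x, x = T.P1.2/b := ⟨_, rfl⟩
  obtain ⟨y2, hy2⟩ : ∃ x, x = T.P2.2/b := ⟨_, rfl⟩
  obtain ⟨y3, hy3⟩ : ∃ x, x = T.P3.2/b := ⟨_, rfl⟩
  rw [← hx1, ← hy1, ← hx2, ← hy2] at q12 ne12
  rw [← hx2, ← hy2, ← hx3, ← hy3] at q23 ne23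
  rw [← hx3, ← hy3, ← hx1, ← hy1] at q31 ne31
  rw [← hx1, ← hy1] at u1
  rw [← hx2, ← hy2] at u2
  rw [← hx3, ← hy3] at u3
  have X1 : T.P1.1 = a*x1 := by rw [hx1]; field_simp
  have X2 : T.P2.1 = a*x2 := by rw [hx2]; field_simp
  have X3 : T.P3.1 = a*x3 := by rw [hx3]; field_simp
  have Y1 : T.P1.2 = b*y1 := by rw [hy1]; field_simp
  have Y2 : T.P2.2 = b*y2 := by rw [hy2]; field_simp
  have Y3 : T.P3.2 = b*y3 := by rw [hy3]; field_simp
  obtain ⟨q, hq⟩ : ∃ q, q = G^2*(a^2-b^2) := ⟨_, rfl⟩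
  have hq0 : 0 ≤ q := by rw [hq, ← hc2]; positivity
  rw [← hq] at q12 q23 q31
  have c12 := cpair q _ x1 y1 x2 y2 u1 u2 q12
  have c23 := cpair q _ x2 y2 x3 y3 u2 u3 q23
  have c31 := cpair q _ x3 y3 x1 y1 u3 u1 q31
  have n1 : (⟨x1,y1⟩:ℂ) ≠ 0 := by
    intro h; have := norm_mk x1 y1 u1; rw [h, norm_zero] at this; exact zero_ne_one this
  obtain ⟨t1, t2, t3⟩ := vieta_aux q _ _ _ _ n1
    (fun h => ne12 (by simpa using h)) (fun h => ne23 (by simpa using h))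
    (fun h => ne31 (by simpa using h)) c12 c23 c31
  have t3' : 2*(1-G^2*(a^2+b^2)) = q^2-1 := by exact_mod_cast t3
  have relc : c^2*q^2+2*q*(a^2+b^2)-3*c^2 = 0 := by
    rw [hc2]; linear_combination -(a^2-b^2)*t3' + 2*(a^2+b^2)*hq
  have hq3 : q < 3 := by
    have : 0 ≤ G^2*(a^2+b^2) := by positivity
    nlinarith
  have hδ0 : 0 ≤ a ^ 4 - a ^ 2 * b ^ 2 + b ^ 4 := by
    rw [show a ^ 4 - a ^ 2 * b ^ 2 + b ^ 4 = (a^2-b^2)^2+(a*b)^2 by ring]; positivity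
  have hδ : δ = (c^2*q+a^2+b^2)/2 := by
    apply (Real.sqrt_eq_iff_mul_self_eq hδ0 (by positivity)).2
    have hc4 : c^4 = (a^2-b^2)^2 := by rw [← hc2]; ring
    linear_combination -(c^2/4)*relc - (3/4)*hc4
  have hk : 0 < (a+b)/2 := by linarith
  have hm0 : 0 < (a-b)/c := div_pos (by linarith) hc
  have hkm : 2*((a+b)/2)*((a-b)/c) = c := by
    field_simp; linear_combination -hc2
  have hkm2 : (a+b)/2*((a-b)/c)^2 = (a-b)/2 := by
    rw [div_pow, hc2]
    have : a^2-b^2 ≠ 0 := by rw [← hc2]; positivity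
    field_simp; ring
  have hm1 : (a-b)/c < 1 := by
    rw [div_lt_one hc]
    apply lt_of_pow_lt_pow_left₀ 2 hc.le
    have : 0 < b*(a-b) := mul_pos hb (by linarith)
    rw [hc2]; linarith [this, show a^2-b^2-(a-b)^2 = 2*(b*(a-b)) by ring]
  have hak : a = (a+b)/2*(1+((a-b)/c)^2) := by linear_combination -hkm2
  have hbk : b = (a+b)/2*(1-((a-b)/c)^2) := by linear_combination hkm2
  have rel : ((a-b)/c)^2*q^2+q*(1+((a-b)/c)^4)-3*((a-b)/c)^2 = 0 := by
    generalize (a-b)/c = m at *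
    generalize (a+b)/2 = k at *
    have : (4*k^2)*(m^2*q^2+q*(1+m^4)-3*m^2) = 0 := by
      rw [← hkm, hak, hbk] at relc
      linear_combination relc
    exact (mul_eq_zero.1 this).resolve_left (by positivity)
  have core := core_aux a b c ((a+b)/2) ((a-b)/c) q x1 y1 x2 y2 x3 y3 hk hm0 hm1 hak hbk hkm.symm
    u1 u2 u3 t1 t2 rel hq3
  have hfoc : ∀ x y : ℝ, x^2+y^2 = 1 → (a*x-(-c))^2+(b*y-0)^2 = (a+c*x)^2 := by
    intro x y h
    linear_combination b^2*h + (1-x^2)*hc2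
  have hrhs : ρ ^ 2 * (2 * a ^ 2 - b ^ 2 - δ) / (3 * a * b ^ 2)
      = ρ^2/3*(a*(c^2*(3-q)/(2*a^2*b^2))) := by
    rw [hδ]; field_simp; linear_combination (-3)*hc2
  have hctr : -c * (1 + ρ ^ 2 * (2 * a ^ 2 - b ^ 2 - δ) / (3 * a ^ 2 * b ^ 2))
      = -c-ρ^2/3*(c*(c^2*(3-q)/(2*a^2*b^2))) := by
    rw [hδ]; field_simp; linear_combination (3*ρ^2)*hc2
  rw [hrhs]
  have hpos : 0 ≤ ρ^2/3*(a*(c^2*(3-q)/(2*a^2*b^2))) := by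
    have : 0 < 3-q := by linarith
    positivity
  unfold dst
  rw [Real.sqrt_eq_iff_mul_self_eq (by positivity) hpos]
  simp only [Ctr, f1, centroid, bary, inva, Prod.smul_fst, Prod.smul_snd, Prod.fst_add,
    Prod.snd_add, Prod.fst_sub, Prod.snd_sub, smul_eq_mul, X1, X2, X3, Y1, Y2, Y3]
  rw [hctr, hfoc _ _ u1, hfoc _ _ u2, hfoc _ _ u3]
  linear_combination (ρ^2/3)^2*core
end
end
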